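/- For every constant c > 3/5, there exists N₀ such that for all integers N ≥ N₀ one has Q(N) < N^c, where Q(N) denotes the maximum number of perfect squares contained in an arithmetic progression of length N. -/

import Mathlib

open scoped Classical in
/-- The number of indices `n ∈ {0, …, N-1}` such that `a + n * d` is an integer square. -/
noncomputable def squaresInAP (N : ℕ) (a d : ℤ) : ℕ :=
  ((Finset.range N).filter fun n => ∃ m : ℤ, a + (n : ℤ) * d = m ^ 2).card

open scoped Classical in
/-- Natural-number version of the set of good indices. -/
noncomputable def goodIdx (N : ℕ) (a d : ℤ) : Finset ℕ :=
  (Finset.range N).filter fun n : ℕ => ∃ m : ℤ, a + (n : ℤ) * d = m ^ 2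

theorem mem_goodIdx {N : ℕ} {a d : ℤ} {n : ℕ} :
    n ∈ goodIdx N a d ↔ n < N ∧ ∃ m : ℤ, a + (n : ℤ) * d = m ^ 2 := by
  classical
  unfold goodIdx
  rw [Finset.mem_filter, Finset.mem_range]

theorem squaresInAP_eq (N : ℕ) (a d : ℤ) : squaresInAP N a d = (goodIdx N a d).card := by
  classical
  unfold squaresInAP
  symm
  refine Finset.card_bij (fun n _ => (n : ℤ)) ?_ ?_ ?_
  · intro n hn
    rw [mem_goodIdx] at hn
    simp only [Finset.mem_filter, Finset.bind_def, Finset.pure_def, Finset.mem_sup,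
      Finset.mem_singleton, Finset.mem_range]
    exact ⟨⟨n, hn.1, rfl⟩, hn.2⟩
  · intro n _ m _ h
    exact_mod_cast h
  · intro z hz
    simp only [Finset.mem_filter, Finset.bind_def, Finset.pure_def, Finset.mem_sup,
      Finset.mem_singleton, Finset.mem_range] at hz
    obtain ⟨⟨n, hn, rfl⟩, h⟩ := hz
    exact ⟨n, mem_goodIdx.mpr ⟨hn, h⟩, rfl⟩


theorem red_coprime (N : ℕ) (a d : ℤ) (hd : 1 ≤ d) :
    (goodIdx N a d).card = 0 ∨ ∃ μ d' : ℤ, 1 ≤ d' ∧ IsCoprime (μ ^ 2) d' ∧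
      (goodIdx N a d).card ≤ (goodIdx N (μ ^ 2) d').card := by
  classical
  rcases Nat.eq_zero_or_pos ((goodIdx N a d).card) with h0 | hpos
  · exact Or.inl h0
  right
  set A := goodIdx N a d with hA
  have hne : A.Nonempty := Finset.card_pos.mp hpos
  set n₀ := A.min' hne with hn₀
  have hn₀A : n₀ ∈ A := A.min'_mem hne
  have hmin : ∀ n ∈ A, n₀ ≤ n := fun n hn => A.min'_le n hn
  -- gcd
  set g := Int.gcd a d with hg
  have hgpos : 0 < g := Int.gcd_pos_of_ne_zero_right a (by omega)
  obtain ⟨a', ha'⟩ : (g : ℤ) ∣ a := Int.gcd_dvd_left a d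
  obtain ⟨d', hd'⟩ : (g : ℤ) ∣ d := Int.gcd_dvd_right a d
  have hgz : (0 : ℤ) < g := by exact_mod_cast hgpos
  have hcop : IsCoprime a' d' := by
    have h1 : (g : ℤ) = a * Int.gcdA a d + d * Int.gcdB a d := Int.gcd_eq_gcd_ab a d
    refine ⟨Int.gcdA a d, Int.gcdB a d, ?_⟩
    have h2 : (g : ℤ) * (Int.gcdA a d * a' + Int.gcdB a d * d') = g * 1 := by
      rw [mul_one]
      calc (g : ℤ) * (Int.gcdA a d * a' + Int.gcdB a d * d')
        = (g * a') * Int.gcdA a d + (g * d') * Int.gcdB a d := by ring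
        _ = g := by rw [← ha', ← hd', ← h1]
    exact mul_left_cancel₀ hgz.ne' h2
  have hd'pos : 1 ≤ d' := by nlinarith
  obtain ⟨g₁n, s, hgs, hsq⟩ := Nat.sq_mul_squarefree g
  obtain ⟨g₁, hg₁⟩ : ∃ g₁ : ℤ, g₁ = g₁n := ⟨_, rfl⟩
  have hsqz : Squarefree g₁ := by rw [hg₁]; exact Int.squarefree_natCast.mpr hsq
  have hgz' : (g : ℤ) = (s : ℤ) ^ 2 * g₁ := by rw [← hgs, hg₁]; push_cast; ring
  have hs0 : (s : ℤ) ≠ 0 := by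
    intro h; rw [h] at hgz'; simp at hgz'; omega
  have hg₁0 : 0 < g₁ := by
    have : g₁ ≠ 0 := by intro h; rw [h] at hgz'; simp at hgz'; omega
    have : 0 ≤ g₁ := by rw [hg₁]; positivity
    omega
  have hgood : ∀ n ∈ A, ∃ μ : ℤ, a' + n * d' = g₁ * μ ^ 2 := by
    intro n hn
    rw [hA, mem_goodIdx] at hn
    obtain ⟨-, m, hm⟩ := hn
    have h1 : (s : ℤ) ^ 2 * (g₁ * (a' + n * d')) = m ^ 2 := by
      rw [← hm, ha', hd', hgz']; ring
    have h2 : (s : ℤ) ∣ m := by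
      rw [← Int.pow_dvd_pow_iff (n := 2) (by norm_num)]
      exact ⟨_, h1.symm⟩
    obtain ⟨m', rfl⟩ := h2
    have h3 : g₁ * (a' + n * d') = m' ^ 2 := by
      apply mul_left_cancel₀ (pow_ne_zero 2 hs0)
      rw [h1]; ring
    have h4 : g₁ ∣ m' := by
      rw [← hsqz.dvd_pow_iff_dvd (n := 2) (by norm_num)]
      exact ⟨_, h3.symm⟩
    obtain ⟨μ, rfl⟩ := h4
    refine ⟨μ, ?_⟩
    apply mul_left_cancel₀ hg₁0.ne'
    rw [h3]; ring
  obtain ⟨μ₀, hμ₀⟩ := hgood n₀ hn₀A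
  have hcop2 : IsCoprime (a' + n₀ * d') d' := by
    have := hcop.add_mul_right_left (n₀ : ℤ)
    exact this
  have hcop3 : IsCoprime (μ₀ ^ 2) d' := by
    apply hcop2.of_isCoprime_of_dvd_left
    exact ⟨g₁, by rw [hμ₀]; ring⟩
  have hcop4 : IsCoprime g₁ d' := by
    apply hcop2.of_isCoprime_of_dvd_left
    exact ⟨μ₀ ^ 2, hμ₀⟩
  refine ⟨μ₀, d', hd'pos, hcop3, ?_⟩
  have hex : ∀ n ∈ A, ∃ t : ℕ, (n : ℤ) = n₀ + g₁ * t ∧ ∃ m : ℤ, μ₀ ^ 2 + t * d' = m ^ 2 := by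
    intro n hn
    obtain ⟨μ, hμ⟩ := hgood n hn
    have h1 : ((n : ℤ) - n₀) * d' = g₁ * (μ ^ 2 - μ₀ ^ 2) := by linarith
    have h2 : g₁ ∣ (n : ℤ) - n₀ := hcop4.dvd_of_dvd_mul_right ⟨_, h1⟩
    obtain ⟨t, ht⟩ := h2
    have hle : (n₀ : ℤ) ≤ n := by exact_mod_cast hmin n hn
    have ht0 : 0 ≤ t := by
      by_contra hneg
      push Not at hneg
      nlinarith
    lift t to ℕ using ht0
    refine ⟨t, by linarith, μ, ?_⟩
    rw [ht] at h1
    have : (t : ℤ) * d' = μ ^ 2 - μ₀ ^ 2 := by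
      apply mul_left_cancel₀ hg₁0.ne'
      rw [← h1]; ring
    linarith
  choose! t ht using hex
  refine Finset.card_le_card_of_injOn t ?_ ?_
  · intro n hn
    rw [Finset.mem_coe, mem_goodIdx]
    refine ⟨?_, (ht n hn).2⟩
    have h1 := (ht n hn).1
    have hnN : n < N := (mem_goodIdx.mp hn).1
    have : (t n : ℤ) ≤ n := by nlinarith [Int.natCast_nonneg (t n), Int.natCast_nonneg n₀]
    omega
  · intro n hn m hm hnm
    have h1 := (ht n hn).1
    have h2 := (ht m hm).1
    rw [hnm, ← h2] at h1
    exact_mod_cast h1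


theorem dv_bound (ε : ℝ) (hε : 0 < ε) :
    ∃ C : ℝ, 1 ≤ C ∧ ∀ n : ℕ, n ≠ 0 → (n.divisors.card : ℝ) ≤ C * (n : ℝ) ^ ε := by
  have hl2 : 0 < Real.log 2 := Real.log_pos (by norm_num)
  obtain ⟨M, hM⟩ := exists_nat_ge ((2 : ℝ) ^ (1 / ε))
  set C₁ : ℝ := 1 + 1 / (ε * Real.log 2) with hC₁
  have hC₁1 : 1 ≤ C₁ := by
    have : 0 < 1 / (ε * Real.log 2) := by positivity
    linarith
  have hsmall : ∀ v : ℕ, (v : ℝ) + 1 ≤ C₁ * (2 : ℝ) ^ (ε * v) := by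
    intro v
    have h1 : (2 : ℝ) ^ (ε * v) = Real.exp (Real.log 2 * (ε * v)) :=
      Real.rpow_def_of_pos (by norm_num) _
    have h2 := Real.add_one_le_exp (Real.log 2 * (ε * v))
    rw [h1]
    have h3 : (v : ℝ) + 1 ≤ C₁ * (Real.log 2 * (ε * v) + 1) := by
      rw [hC₁]
      have : (1 + 1 / (ε * Real.log 2)) * (Real.log 2 * (ε * v) + 1)
        = Real.log 2 * (ε * v) + 1 + v + 1 / (ε * Real.log 2) := by
        field_simp; ring
      rw [this]
      have h4 : 0 ≤ Real.log 2 * (ε * v) := by positivity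
      have h5 : 0 < 1 / (ε * Real.log 2) := by positivity
      linarith
    exact h3.trans (mul_le_mul_of_nonneg_left h2 (by linarith))
  refine ⟨C₁ ^ M, one_le_pow₀ hC₁1, fun n hn => ?_⟩
  rw [Nat.card_divisors hn]
  push_cast
  have hterm : ∀ p ∈ n.primeFactors, ((n.factorization p : ℝ) + 1) ≤
      (if p < M then C₁ else 1) * ((p : ℝ) ^ (n.factorization p)) ^ ε := by
    intro p hp
    have hpp := Nat.prime_of_mem_primeFactors hp
    have hp2 : (2 : ℝ) ≤ p := by exact_mod_cast hpp.two_le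
    set v := n.factorization p
    have e1 : ((p : ℝ) ^ v) ^ ε = ((p : ℝ) ^ ε) ^ v := by
      rw [← Real.rpow_natCast, ← Real.rpow_mul (by positivity), mul_comm,
        Real.rpow_mul (by positivity), Real.rpow_natCast]
    split_ifs with hpM
    · refine (hsmall v).trans (mul_le_mul_of_nonneg_left ?_ (by linarith))
      rw [e1, Real.rpow_mul (by norm_num), Real.rpow_natCast]
      gcongr
    · rw [one_mul, e1]
      have h2 : (2 : ℝ) ≤ (p : ℝ) ^ ε := by
        have h3 : (2 : ℝ) ^ (1 / ε) ≤ p := hM.trans (by exact_mod_cast not_lt.mp hpM)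
        calc (2 : ℝ) = ((2 : ℝ) ^ (1 / ε)) ^ ε := by
              rw [← Real.rpow_mul (by norm_num)]; field_simp; simp
          _ ≤ _ := by gcongr
      calc (v : ℝ) + 1 ≤ (2 : ℝ) ^ v := by exact_mod_cast Nat.lt_two_pow_self
        _ ≤ _ := by gcongr
  calc ∏ p ∈ n.primeFactors, ((n.factorization p : ℝ) + 1)
      ≤ ∏ p ∈ n.primeFactors, ((if p < M then C₁ else 1) * ((p : ℝ) ^ (n.factorization p)) ^ ε) :=
        Finset.prod_le_prod (fun _ _ => by positivity) hterm
    _ = (∏ p ∈ n.primeFactors, (if p < M then C₁ else 1)) *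
        (∏ p ∈ n.primeFactors, (p : ℝ) ^ (n.factorization p)) ^ ε := by
        rw [Finset.prod_mul_distrib, Real.finset_prod_rpow _ _ (fun _ _ => by positivity)]
    _ = (∏ p ∈ n.primeFactors, (if p < M then C₁ else 1)) * (n : ℝ) ^ ε := by
        congr 2
        have := Nat.prod_factorization_pow_eq_self hn
        rw [Finsupp.prod, Nat.support_factorization] at this
        exact_mod_cast this
    _ ≤ C₁ ^ M * (n : ℝ) ^ ε := by
        gcongr
        rw [Finset.prod_ite]
        simp only [Finset.prod_const, one_pow, mul_one]
        apply pow_le_pow_right₀ hC₁1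
        calc _ ≤ (Finset.range M).card := by
              apply Finset.card_le_card
              intro p hp
              simp only [Finset.mem_filter] at hp
              simpa using hp.2
          _ = M := by simp


theorem three_gcd (d y₁ y₂ y₃ : ℤ) (h12 : d ∣ y₁ ^ 2 - y₂ ^ 2) (h13 : d ∣ y₁ ^ 2 - y₃ ^ 2) :
    d ∣ (Int.gcd d (y₁ - y₂) : ℤ) * (Int.gcd d (y₁ - y₃)) * (Int.gcd d (y₂ - y₃)) := by
  rw [Int.coe_gcd, Int.coe_gcd, Int.coe_gcd]
  have h1 : d ∣ gcd d (y₁ - y₂) * gcd d (y₁ + y₂) := by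
    have : d ∣ (y₁ - y₂) * (y₁ + y₂) := by
      convert h12 using 1; ring
    have h2 := dvd_gcd_mul_of_dvd_mul this
    rw [mul_comm] at h2
    have h3 := dvd_gcd_mul_of_dvd_mul h2
    rwa [mul_comm] at h3
  set g' := gcd d (y₁ + y₂) with hg'
  have hg'd : g' ∣ d := gcd_dvd_left _ _
  have h2 : g' ∣ gcd g' (y₁ - y₃) * gcd g' (y₁ + y₃) := by
    have : g' ∣ (y₁ - y₃) * (y₁ + y₃) := by
      have e : (y₁ - y₃) * (y₁ + y₃) = y₁ ^ 2 - y₃ ^ 2 := by ring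
      rw [e]
      exact hg'd.trans h13
    have h2 := dvd_gcd_mul_of_dvd_mul this
    rw [mul_comm] at h2
    have h3 := dvd_gcd_mul_of_dvd_mul h2
    rwa [mul_comm] at h3
  have h3 : gcd g' (y₁ - y₃) ∣ gcd d (y₁ - y₃) :=
    dvd_gcd ((gcd_dvd_left _ _).trans hg'd) (gcd_dvd_right _ _)
  have h4 : gcd g' (y₁ + y₃) ∣ gcd d (y₂ - y₃) := by
    refine dvd_gcd ((gcd_dvd_left _ _).trans hg'd) ?_
    have e1 : gcd g' (y₁ + y₃) ∣ y₁ + y₂ := (gcd_dvd_left _ _).trans (gcd_dvd_right _ _)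
    have e2 : gcd g' (y₁ + y₃) ∣ y₁ + y₃ := gcd_dvd_right _ _
    have := dvd_sub e1 e2
    convert this using 1; ring
  rw [mul_assoc]
  exact h1.trans (mul_dvd_mul_left _ (h2.trans (mul_dvd_mul h3 h4)))

theorem large_a (N : ℕ) (a d : ℤ) (ha : 1 ≤ a) (hd : 1 ≤ d) (n₁ n₂ n₃ : ℕ)
    (h1 : n₁ ∈ goodIdx N a d) (h2 : n₂ ∈ goodIdx N a d) (h3 : n₃ ∈ goodIdx N a d)
    (h12 : n₁ ≠ n₂) (h13 : n₁ ≠ n₃) (h23 : n₂ ≠ n₃) : a ^ 3 ≤ (N : ℤ) ^ 6 * d ^ 4 := by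
  have key : ∀ n ∈ goodIdx N a d, ∃ x : ℤ, 0 ≤ x ∧ a + n * d = x ^ 2 := by
    intro n hn
    obtain ⟨-, m, hm⟩ := mem_goodIdx.mp hn
    exact ⟨|m|, abs_nonneg _, by rw [sq_abs]; exact hm⟩
  obtain ⟨x₁, hx₁0, hx₁⟩ := key n₁ h1
  obtain ⟨x₂, hx₂0, hx₂⟩ := key n₂ h2
  obtain ⟨x₃, hx₃0, hx₃⟩ := key n₃ h3
  have hN1 := (mem_goodIdx.mp h1).1
  have hN2 := (mem_goodIdx.mp h2).1
  have hN3 := (mem_goodIdx.mp h3).1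
  have pair : ∀ (n m : ℕ) (x y : ℤ), n < N → m < N → n ≠ m → 0 ≤ x → 0 ≤ y → a + n * d = x ^ 2 →
      a + m * d = y ^ 2 → x - y ≠ 0 ∧ (x - y) ^ 2 * a ≤ (N : ℤ) ^ 2 * d ^ 2 := by
    intro n m x y hn hm hnm hx0 hy0 hx hy
    constructor
    · intro h
      have : x = y := by linarith
      subst this
      have h5 : ((n : ℤ) - m) * d = 0 := by linarith
      rcases mul_eq_zero.mp h5 with h6 | h6
      · apply hnm; omega
      · omega
    · have e : (x - y) * (x + y) = ((n : ℤ) - m) * d := by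
        have : x ^ 2 - y ^ 2 = ((n : ℤ) - m) * d := by rw [← hx, ← hy]; ring
        rw [← this]; ring
      have hxa : a ≤ (x + y) ^ 2 := by
        have : 0 ≤ (n : ℤ) * d := by positivity
        nlinarith [mul_nonneg hx0 hy0, sq_nonneg y]
      have hnm2 : ((n : ℤ) - m) ^ 2 ≤ (N : ℤ) ^ 2 := by
        apply sq_le_sq'
        · omega
        · omega
      calc (x - y) ^ 2 * a ≤ (x - y) ^ 2 * (x + y) ^ 2 := by gcongr
        _ = ((x - y) * (x + y)) ^ 2 := by ring
        _ = ((n : ℤ) - m) ^ 2 * d ^ 2 := by rw [e]; ring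
        _ ≤ _ := by gcongr
  obtain ⟨a12, b12⟩ := pair n₁ n₂ x₁ x₂ hN1 hN2 h12 hx₁0 hx₂0 hx₁ hx₂
  obtain ⟨a13, b13⟩ := pair n₁ n₃ x₁ x₃ hN1 hN3 h13 hx₁0 hx₃0 hx₁ hx₃
  obtain ⟨a23, b23⟩ := pair n₂ n₃ x₂ x₃ hN2 hN3 h23 hx₂0 hx₃0 hx₂ hx₃
  have hdvd : d ∣ (x₁ - x₂) * (x₁ - x₃) * (x₂ - x₃) := by
    refine (three_gcd d x₁ x₂ x₃ ⟨(n₁ : ℤ) - n₂, ?_⟩ ⟨(n₁ : ℤ) - n₃, ?_⟩).trans ?_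
    · rw [← hx₁, ← hx₂]; ring
    · rw [← hx₁, ← hx₃]; ring
    · exact mul_dvd_mul (mul_dvd_mul (Int.gcd_dvd_right _ _) (Int.gcd_dvd_right _ _))
        (Int.gcd_dvd_right _ _)
  have hle : d ^ 2 ≤ ((x₁ - x₂) * (x₁ - x₃) * (x₂ - x₃)) ^ 2 := by
    have h0 : (x₁ - x₂) * (x₁ - x₃) * (x₂ - x₃) ≠ 0 := mul_ne_zero (mul_ne_zero a12 a13) a23
    apply Int.le_of_dvd (by positivity)
    exact pow_dvd_pow_of_dvd hdvd 2
  have : d ^ 2 * a ^ 3 ≤ d ^ 2 * ((N : ℤ) ^ 6 * d ^ 4) := by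
    calc d ^ 2 * a ^ 3 ≤ ((x₁ - x₂) * (x₁ - x₃) * (x₂ - x₃)) ^ 2 * a ^ 3 := by gcongr
      _ = ((x₁ - x₂) ^ 2 * a) * ((x₁ - x₃) ^ 2 * a) * ((x₂ - x₃) ^ 2 * a) := by ring
      _ ≤ ((N : ℤ) ^ 2 * d ^ 2) * ((N : ℤ) ^ 2 * d ^ 2) * ((N : ℤ) ^ 2 * d ^ 2) := by
        gcongr
      _ = _ := by ring
  exact le_of_mul_le_mul_left this (by positivity)

theorem same_class (d g x₀ x x' : ℤ) (hd : 1 ≤ d) (hcop : IsCoprime x₀ d)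
    (hx : d ∣ (x - x₀) * (x + x₀)) (hx' : d ∣ (x' - x₀) * (x' + x₀))
    (hg : (Int.gcd d (x - x₀) : ℤ) = g) (hg' : (Int.gcd d (x' - x₀) : ℤ) = g) :
    d ∣ 2 * (x - x') := by
  have hg0 : 0 < g := by
    rw [← hg]; exact_mod_cast Int.gcd_pos_of_ne_zero_left _ (by omega)
  obtain ⟨d1, hd1⟩ : g ∣ d := hg ▸ Int.gcd_dvd_left _ _
  have aux : ∀ z : ℤ, d ∣ (z - x₀) * (z + x₀) → (Int.gcd d (z - x₀) : ℤ) = g →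
      g ∣ z - x₀ ∧ d1 ∣ z + x₀ := by
    intro z hz hgz
    obtain ⟨y, hy⟩ : g ∣ z - x₀ := hgz ▸ Int.gcd_dvd_right _ _
    refine ⟨⟨y, hy⟩, ?_⟩
    have h1 : d ∣ gcd d (z - x₀) * (z + x₀) := dvd_gcd_mul_of_dvd_mul hz
    rw [← Int.coe_gcd, hgz, hd1] at h1
    exact (mul_dvd_mul_iff_left hg0.ne').mp h1
  obtain ⟨e1, e2⟩ := aux x hx hg
  obtain ⟨e3, e4⟩ := aux x' hx' hg'
  have f1 : g ∣ x - x' := by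
    have e : x - x' = (x - x₀) - (x' - x₀) := by ring
    rw [e]
    exact dvd_sub e1 e3
  have f2 : d1 ∣ x - x' := by
    have e : x - x' = (x + x₀) - (x' + x₀) := by ring
    rw [e]
    exact dvd_sub e2 e4
  have f3 : (Int.gcd g d1 : ℤ) ∣ 2 := by
    have a1 : (Int.gcd g d1 : ℤ) ∣ x - x₀ := (Int.gcd_dvd_left _ _).trans e1
    have a2 : (Int.gcd g d1 : ℤ) ∣ x + x₀ := (Int.gcd_dvd_right _ _).trans e2
    have a3 : (Int.gcd g d1 : ℤ) ∣ d := (Int.gcd_dvd_left _ _).trans ⟨d1, hd1⟩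
    have a4 : (Int.gcd g d1 : ℤ) ∣ x₀ * 2 := by
      have e : x₀ * 2 = (x + x₀) - (x - x₀) := by ring
      rw [e]
      exact dvd_sub a2 a1
    exact (hcop.symm.of_isCoprime_of_dvd_left a3).dvd_of_dvd_mul_left a4
  have f4 : d ∣ (Int.gcd g d1 : ℤ) * (x - x') := by
    rw [Int.gcd_eq_gcd_ab g d1, hd1, add_mul]
    apply dvd_add
    · obtain ⟨k, hk⟩ := f2
      exact ⟨Int.gcdA g d1 * k, by rw [hk]; ring⟩
    · obtain ⟨k, hk⟩ := f1
      exact ⟨Int.gcdB g d1 * k, by rw [hk]; ring⟩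
  exact f4.trans (mul_dvd_mul_right f3 _)

theorem small_d (N : ℕ) (a d : ℤ) (hd : 1 ≤ d) (hcop : IsCoprime a d) :
    (goodIdx N a d).card ≤ (Nat.sqrt (4 * N) + 1) * d.natAbs.divisors.card := by
  classical
  set A := goodIdx N a d with hA
  rcases A.eq_empty_or_nonempty with he | ⟨n₀, hn₀⟩
  · rw [he]; simp
  have key : ∀ n ∈ A, ∃ x : ℤ, 0 ≤ x ∧ a + n * d = x ^ 2 := by
    intro n hn
    obtain ⟨-, m, hm⟩ := mem_goodIdx.mp hn
    exact ⟨|m|, abs_nonneg _, by rw [sq_abs]; exact hm⟩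
  choose! x hx0 hx using key
  have hc0 : IsCoprime (x n₀) d := by
    have h1 := hcop.add_mul_right_left (n₀ : ℤ)
    rw [hx n₀ hn₀] at h1
    exact h1.of_isCoprime_of_dvd_left ⟨x n₀, by ring⟩
  have hdv : ∀ n ∈ A, d ∣ (x n - x n₀) * (x n + x n₀) := by
    intro n hn
    refine ⟨(n : ℤ) - n₀, ?_⟩
    have h1 := hx n hn
    have h2 := hx n₀ hn₀
    linear_combination h2 - h1
  have hxinj : ∀ n ∈ A, ∀ m ∈ A, x n = x m → n = m := by
    intro n hn m hm h
    have h1 := hx n hn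
    have h2 := hx m hm
    rw [h, ← h2] at h1
    have h3 : ((n : ℤ) - m) * d = 0 := by linarith
    rcases mul_eq_zero.mp h3 with h4 | h4
    · omega
    · omega
  refine Finset.card_le_mul_card_image_of_maps_to (f := fun n => Int.gcd d (x n - x n₀))
    (t := d.natAbs.divisors) ?_ _ ?_
  · intro n hn
    rw [Nat.mem_divisors]
    refine ⟨Int.gcd_dvd_natAbs_left _ _, by omega⟩
  · intro g _
    set F := A.filter (fun n => Int.gcd d (x n - x n₀) = g) with hF
    rcases F.eq_empty_or_nonempty with he | hne
    · rw [he]; simp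
    set m := F.min' hne with hm
    have hmF : m ∈ F := F.min'_mem hne
    have hmm : ∀ n ∈ F, m ≤ n := fun n hn => F.min'_le n hn
    have hFA : ∀ n ∈ F, n ∈ A := fun n hn => (Finset.mem_filter.mp hn).1
    have hmx : ∀ n ∈ F, x m ≤ x n := by
      intro n hn
      have h1 := hx n (hFA n hn)
      have h2 := hx m (hFA m hmF)
      have h3 : (m : ℤ) ≤ n := by exact_mod_cast hmm n hn
      have h4 : x m ^ 2 ≤ x n ^ 2 := by rw [← h1, ← h2]; nlinarith
      exact (sq_le_sq₀ (hx0 m (hFA m hmF)) (hx0 n (hFA n hn))).mp h4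
    have ht : ∀ n ∈ F, ∃ t : ℕ, 2 * (x n - x m) = d * t := by
      intro n hn
      obtain ⟨t, ht⟩ := same_class d g (x n₀) (x n) (x m) hd hc0 (hdv n (hFA n hn))
        (hdv m (hFA m hmF)) (by exact_mod_cast (Finset.mem_filter.mp hn).2)
        (by exact_mod_cast (Finset.mem_filter.mp hmF).2)
      have h5 := hmx n hn
      have : 0 ≤ t := by
        by_contra hneg
        push Not at hneg
        nlinarith
      lift t to ℕ using this
      exact ⟨t, ht⟩
    choose! t ht using ht
    have : F.card ≤ (Finset.range (Nat.sqrt (4 * N) + 1)).card := by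
      refine Finset.card_le_card_of_injOn t ?_ ?_
      · intro n hn
        have hn : n ∈ F := hn
        rw [Finset.mem_coe, Finset.mem_range, Nat.lt_succ_iff, Nat.le_sqrt']
        have h1 := hx n (hFA n hn)
        have h2 := hx m (hFA m hmF)
        have h3 := ht n hn
        have h4 := hmx n hn
        have h5 := hx0 m (hFA m hmF)
        have hnN : n < N := (mem_goodIdx.mp (hFA n hn)).1
        have h6 : (x n - x m) ^ 2 ≤ N * d := by
          have : (x n - x m) ^ 2 ≤ x n ^ 2 - x m ^ 2 := by nlinarith
          rw [← h1, ← h2] at this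
          have h7 : ((n : ℤ) - m) * d ≤ N * d := by
            apply mul_le_mul_of_nonneg_right _ (by omega)
            omega
          linarith
        have h8 : d * (d * (t n : ℤ) ^ 2) ≤ d * (4 * N) := by
          calc d * (d * (t n : ℤ) ^ 2) = (d * t n) ^ 2 := by ring
            _ = 4 * (x n - x m) ^ 2 := by rw [← h3]; ring
            _ ≤ _ := by linarith
        have h9 := le_of_mul_le_mul_left h8 (by omega)
        have h10 : (t n : ℤ) ^ 2 ≤ d * (t n : ℤ) ^ 2 := by nlinarith [sq_nonneg (t n : ℤ)]
        exact_mod_cast h10.trans h9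
      · intro n hn k hk hnk
        have h1 := ht n hn
        have h2 := ht k hk
        rw [hnk, ← h2] at h1
        exact hxinj n (hFA n hn) k (hFA k hk) (by linarith)
    simpa using this


section Packing
variable {G : Type*} [AddCommGroup G]

theorem pk_ncard_step (h : G → ℝ) (C : ℝ) 
    (hneg : ∀ x, h (-x) = h x)
    (hadd : ∀ x y, h (x + y) ≤ 2 * h x + 2 * h y + C)
    (hdbl : ∀ x, 4 * h x - C ≤ h (x + x))
    (hfin : ∀ R : ℝ, {x | h x ≤ R}.Finite)
    {T : Type*} [Fintype T] (f : G → T)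
    (hf : ∀ x y, f x = f y → ∃ u, x - y = u + u) :
    ∃ R1 : ℝ, 0 ≤ R1 ∧ ∀ R : ℝ, {x | h x ≤ R}.ncard ≤
      Fintype.card T * {x | h x ≤ (R + R1) / 2}.ncard := by
  classical
  have hr : ∃ r : T → G, ∀ x, f (r (f x)) = f x := by
    refine ⟨fun t => if ht : ∃ x, f x = t then ht.choose else 0, fun x => ?_⟩
    have ht : ∃ z, f z = f x := ⟨x, rfl⟩
    simp only [ht, dif_pos]
    exact ht.choose_spec
  obtain ⟨r, hr⟩ := hr
  have hu : ∃ u : G → G, ∀ x, x - r (f x) = u x + u x := by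
    choose u hu using fun x => hf x (r (f x)) (hr x).symm
    exact ⟨u, hu⟩
  obtain ⟨u, hu⟩ := hu
  refine ⟨∑ t, |h (r t)| + |C|, by positivity, fun R => ?_⟩
  have hle : ∀ x, h x ≤ R → h (u x) ≤ (R + (∑ t, |h (r t)| + |C|)) / 2 := by
    intro x hx
    have h1 := hdbl (u x)
    rw [← hu x, sub_eq_add_neg x (r (f x))] at h1
    have h2 := hadd x (-(r (f x)))
    rw [hneg] at h2
    have h3 : |h (r (f x))| ≤ ∑ t, |h (r t)| :=
      Finset.single_le_sum (f := fun t => |h (r t)|) (fun i _ => abs_nonneg _) (Finset.mem_univ _)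
    have h4 := le_abs_self (h (r (f x)))
    have h5 := le_abs_self C
    linarith
  set R' := (R + (∑ t, |h (r t)| + |C|)) / 2
  have hf2 := hfin R'
  have key : {x | h x ≤ R}.ncard ≤ ((Set.univ : Set T) ×ˢ {x | h x ≤ R'}).ncard := by
    refine Set.ncard_le_ncard_of_injOn (fun x => (f x, u x)) ?_ ?_ (Set.finite_univ.prod hf2)
    · intro x hx
      exact ⟨Set.mem_univ _, hle x hx⟩
    · intro x _ y _ hxy
      simp only [Prod.mk.injEq] at hxy
      have h1 := hu x
      have h2 := hu y
      rw [hxy.1, hxy.2, ← h2] at h1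
      exact sub_left_injective h1
  rwa [Set.ncard_prod, Set.ncard_univ, Nat.card_eq_fintype_card] at key

theorem pk_pow_dbl (h : G → ℝ) (C : ℝ)
    (hadd : ∀ x y, h (x + y) ≤ 2 * h x + 2 * h y + C)
    (hdbl : ∀ x, 4 * h x - C ≤ h (x + x)) (z : G) (k : ℕ) :
    4 ^ k * (h z - C / 3) + C / 3 ≤ h ((2 ^ k) • z) ∧
     h ((2 ^ k) • z) ≤ 4 ^ k * (h z + C / 3) - C / 3 := by
  induction k with
  | zero => simp
  | succ k ih =>
    have e : (2 ^ (k + 1)) • z = (2 ^ k) • z + (2 ^ k) • z := by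
      rw [pow_succ, mul_two, add_smul]
    rw [e]
    have h1 := hadd ((2 ^ k) • z) ((2 ^ k) • z)
    have h2 := hdbl ((2 ^ k) • z)
    have h3 : (4 : ℝ) ^ (k + 1) = 4 * 4 ^ k := by ring
    rw [h3]
    constructor <;> nlinarith [ih.1, ih.2]

theorem pk_main (h : G → ℝ) (C : ℝ) (hC : 0 ≤ C)
    (hneg : ∀ x, h (-x) = h x)
    (hadd : ∀ x y, h (x + y) ≤ 2 * h x + 2 * h y + C)
    (hdbl : ∀ x, 4 * h x - C ≤ h (x + x))
    (hfin : ∀ R : ℝ, {x | h x ≤ R}.Finite)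
    {T : Type*} [Fintype T] (f : G → T)
    (hf : ∀ x y, f x = f y → ∃ u, x - y = u + u)
    (β B : ℝ) (hβ : 0 < β) (hβC : 10 * C ≤ β) (hB : B ≤ 8 * β)
    (S : Finset G) (hS : ∀ P ∈ S, h P ≤ B)
    (hsep : ∀ P ∈ S, ∀ Q ∈ S, P ≠ Q → β ≤ h (P - Q)) :
    S.card ≤ Fintype.card T ^ 8 := by
  classical
  obtain ⟨R1, hR1, hstep⟩ := pk_ncard_step h C hneg hadd hdbl hfin f hf
  set D := Fintype.card T
  set n : ℝ → ℕ := fun R => {x | h x ≤ R}.ncard with hn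
  have hnmono : ∀ R R', R ≤ R' → n R ≤ n R' := fun R R' hh =>
    Set.ncard_le_ncard (fun x (hx : h x ≤ R) => (hx.trans hh : h x ≤ R')) (hfin R')
  have hit : ∀ (k : ℕ) (R : ℝ), n (2 ^ k * R + R1) ≤ D ^ k * n (R + R1) := by
    intro k R
    induction k with
    | zero => simp
    | succ k ih =>
      have h1 := hstep (2 ^ (k + 1) * R + R1)
      have e : (2 ^ (k + 1) * R + R1 + R1) / 2 = 2 ^ k * R + R1 := by ring
      rw [e] at h1
      calc n (2 ^ (k + 1) * R + R1) ≤ D * n (2 ^ k * R + R1) := h1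
        _ ≤ D * (D ^ k * n (R + R1)) := Nat.mul_le_mul_left _ ih
        _ = D ^ (k + 1) * n (R + R1) := by ring
  set ρ := β / 8 with hρ
  have hρ0 : 0 < ρ := by positivity
  have hdisj : ∀ k : ℕ, S.card * n (4 ^ k * ρ) ≤ n (4 ^ (k + 4) * ρ) := by
    intro k
    have h4 : (1 : ℝ) ≤ 4 ^ k := one_le_pow₀ (by norm_num)
    have key : ((S : Set G) ×ˢ {x | h x ≤ 4 ^ k * ρ}).ncard ≤ n (4 ^ (k + 4) * ρ) := by
      refine Set.ncard_le_ncard_of_injOn (fun p => (2 ^ k) • p.1 + p.2) ?_ ?_ (hfin _)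
      · rintro ⟨P, u⟩ ⟨hP, hu⟩
        simp only [Set.mem_ofPred_eq] at hu ⊢
        have h1 := hadd ((2 ^ k) • P) u
        have h2 := (pk_pow_dbl h C hadd hdbl P k).2
        have h3 := hS P hP
        have h5 : (4 : ℝ) ^ (k + 4) = 256 * 4 ^ k := by ring
        rw [h5]
        have : h P + C / 3 ≤ 65 * ρ := by linarith
        have h6 := mul_le_mul_of_nonneg_left this (by positivity : (0 : ℝ) ≤ 4 ^ k)
        have h7 : C ≤ ρ := by linarith
        have h8 : ρ ≤ 4 ^ k * ρ := by nlinarith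
        linarith
      · rintro ⟨P, u⟩ ⟨hP, hu⟩ ⟨Q, v⟩ ⟨hQ, hv⟩ he
        simp only [Set.mem_ofPred_eq] at hu hv he
        by_cases hPQ : P = Q
        · subst hPQ
          simpa using he
        · exfalso
          have h1 := hsep P hP Q hQ hPQ
          have h2 := (pk_pow_dbl h C hadd hdbl (P - Q) k).1
          have e : (2 ^ k) • (P - Q) = v + -u := by
            rw [smul_sub]
            have := congrArg (fun z => z - u - (2 ^ k) • Q) he
            simp only [add_sub_cancel_right] at this
            rw [this]; abel
          rw [e] at h2
          have h3 := hadd v (-u)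
          rw [hneg] at h3
          have h6 : 8 * ρ - C / 3 ≤ h (P - Q) - C / 3 := by linarith
          have h7 := mul_le_mul_of_nonneg_left h6 (by positivity : (0 : ℝ) ≤ 4 ^ k)
          have h8 : 0 < 4 * ρ - C := by linarith
          have h9 : 4 * ρ - C / 3 ≤ 4 ^ k * (4 * ρ - C / 3) := by nlinarith
          linarith
    rwa [Set.ncard_prod, Set.ncard_coe_finset] at key
  have hn0 : 1 ≤ n ρ := by
    have h1 := hdbl 0
    rw [add_zero] at h1
    have : (0 : G) ∈ {x | h x ≤ ρ} := by
      simp only [Set.mem_ofPred_eq]; linarith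
    exact Nat.one_le_iff_ne_zero.mpr (Set.ncard_ne_zero_of_mem this (hfin ρ))
  have hpow : ∀ j : ℕ, S.card ^ j ≤ n (4 ^ (4 * j) * ρ) := by
    intro j
    induction j with
    | zero => simpa using hn0
    | succ j ih =>
      have := hdisj (4 * j)
      calc S.card ^ (j + 1) = S.card * S.card ^ j := by ring
        _ ≤ S.card * n (4 ^ (4 * j) * ρ) := Nat.mul_le_mul_left _ ih
        _ ≤ _ := this
  have hfinal : ∀ j : ℕ, S.card ^ j ≤ (D ^ 8) ^ j * n (ρ + R1) := by
    intro j
    have h1 := hit (8 * j) ρ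
    have h2 : n (4 ^ (4 * j) * ρ) ≤ n (2 ^ (8 * j) * ρ + R1) := by
      apply hnmono
      have : (4 : ℝ) ^ (4 * j) = 2 ^ (8 * j) := by
        rw [pow_mul, pow_mul]; norm_num
      rw [this]; linarith
    rw [← pow_mul]
    exact (hpow j).trans (h2.trans h1)
  by_contra hcon
  push Not at hcon
  have hD : 0 < D := Fintype.card_pos_iff.mpr ⟨f 0⟩
  have hD8 : (0 : ℝ) < (D : ℝ) ^ 8 := by positivity
  have hgt : 1 < (S.card : ℝ) / (D : ℝ) ^ 8 := by
    rw [one_lt_div hD8]; exact_mod_cast hcon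
  obtain ⟨j, hj⟩ := pow_unbounded_of_one_lt (n (ρ + R1) : ℝ) hgt
  have h1 : ((S.card : ℝ)) ^ j ≤ ((D : ℝ) ^ 8) ^ j * n (ρ + R1) := by exact_mod_cast hfinal j
  rw [div_pow, lt_div_iff₀ (by positivity)] at hj
  linarith

theorem pk_triple (h : G → ℝ) (C : ℝ) (hC : 0 ≤ C)
    (hneg : ∀ x, h (-x) = h x)
    (hadd : ∀ x y, h (x + y) ≤ 2 * h x + 2 * h y + C)
    (hdbl : ∀ x, 4 * h x - C ≤ h (x + x))
    (hfin : ∀ R : ℝ, {x | h x ≤ R}.Finite)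
    {T : Type*} [Fintype T] (f : G → T)
    (hf : ∀ x y, f x = f y → ∃ u, x - y = u + u)
    (β B : ℝ) (hβ : 0 < β) (hβC : 10 * C ≤ β) (hB : B ≤ 8 * β)
    (S : Finset G) (hS : ∀ P ∈ S, h P ≤ B)
    (hsep : ∀ P ∈ S, ∀ Q ∈ S, ∀ R ∈ S, P ≠ Q → P ≠ R → Q ≠ R →
      β ≤ h (P - Q) ∨ β ≤ h (P - R) ∨ β ≤ h (Q - R)) :
    S.card ≤ 2 * Fintype.card T ^ 16 := by
  classical
  set D := Fintype.card T
  have hD : 1 ≤ D := Fintype.card_pos_iff.mpr ⟨f 0⟩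
  have hmain : ∀ S' ⊆ S, (∀ P ∈ S', ∀ Q ∈ S', P ≠ Q → β ≤ h (P - Q)) → S'.card ≤ D ^ 8 :=
    fun S' hS' hh => pk_main h C hC hneg hadd hdbl hfin f hf β B hβ hβC hB S'
      (fun P hP => hS P (hS' hP)) hh
  have hsymm : ∀ P Q, h (P - Q) = h (Q - P) := fun P Q => by rw [← hneg, neg_sub]
  -- maximal separated subset
  obtain ⟨sep, hsepd⟩ : ∃ sep : Finset G → Prop, ∀ S', sep S' ↔
      ∀ P ∈ S', ∀ Q ∈ S', P ≠ Q → β ≤ h (P - Q) := ⟨_, fun _ => Iff.rfl⟩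
  obtain ⟨S', hS'mem, hS'max⟩ := Finset.exists_max_image
    (S.powerset.filter sep) Finset.card ⟨∅, by simp [hsepd]⟩
  rw [Finset.mem_filter, Finset.mem_powerset, hsepd] at hS'mem
  have hcov : S ⊆ S' ∪ S'.biUnion (fun P => S.filter (fun Q => Q ≠ P ∧ h (P - Q) < β)) := by
    intro Q hQ
    by_cases hQS : Q ∈ S'
    · exact Finset.mem_union_left _ hQS
    · apply Finset.mem_union_right
      by_contra hno
      simp only [Finset.mem_biUnion, Finset.mem_filter, not_exists, not_and, not_lt] at hno
      have hno' : ∀ P ∈ S', β ≤ h (P - Q) := fun P hP =>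
        hno P hP hQ (fun e => hQS (e ▸ hP))
      have hins := hS'max (insert Q S') (by
        rw [Finset.mem_filter, Finset.mem_powerset, hsepd]
        refine ⟨Finset.insert_subset hQ hS'mem.1, ?_⟩
        intro P hP R hR hPR
        rw [Finset.mem_insert] at hP hR
        rcases hP with rfl | hP <;> rcases hR with rfl | hR
        · exact absurd rfl hPR
        · rw [hsymm]; exact hno' R hR
        · exact hno' P hP
        · exact hS'mem.2 P hP R hR hPR)
      rw [Finset.card_insert_of_notMem hQS] at hins
      omega
  have hnb : ∀ P ∈ S', (S.filter (fun Q => Q ≠ P ∧ h (P - Q) < β)).card ≤ D ^ 8 := by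
    intro P hP
    apply hmain _ (Finset.filter_subset _ _)
    intro Q hQ R hR hQR
    rw [Finset.mem_filter] at hQ hR
    rcases hsep P (hS'mem.1 hP) Q hQ.1 R hR.1 (Ne.symm hQ.2.1) (Ne.symm hR.2.1) hQR with h1 | h1 | h1
    · linarith [hQ.2.2]
    · linarith [hR.2.2]
    · exact h1
  have hc1 := hmain S' hS'mem.1 hS'mem.2
  calc S.card ≤ S'.card + (S'.biUnion (fun P => S.filter (fun Q => Q ≠ P ∧ h (P - Q) < β))).card :=
        (Finset.card_le_card hcov).trans (Finset.card_union_le _ _)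
    _ ≤ D ^ 8 + S'.card * D ^ 8 := by
        gcongr
        exact Finset.card_biUnion_le_card_mul _ _ _ hnb
    _ ≤ D ^ 8 + D ^ 8 * D ^ 8 := by gcongr
    _ ≤ 2 * D ^ 16 := by
        have : D ^ 8 ≤ D ^ 16 := Nat.pow_le_pow_right hD (by norm_num)
        have e : D ^ 8 * D ^ 8 = D ^ 16 := by ring
        omega
end Packing


/-- The curve `y² = (x-e₁)(x-e₂)(x-e₃)` over `ℚ`. -/
def crv (e₁ e₂ e₃ : ℤ) : WeierstrassCurve.Affine ℚ :=
  { a₁ := 0, a₂ := -(e₁ + e₂ + e₃), a₃ := 0, a₄ := e₁ * e₂ + e₁ * e₃ + e₂ * e₃,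
    a₆ := -(e₁ * e₂ * e₃) }

section Crv
open WeierstrassCurve.Affine
variable {e₁ e₂ e₃ : ℤ}

theorem crv_eqn {x y : ℚ} : (crv e₁ e₂ e₃).Equation x y ↔
    y ^ 2 = (x - e₁) * (x - e₂) * (x - e₃) := by
  rw [equation_iff]
  simp only [crv]
  constructor <;> intro h <;> linear_combination h

theorem crv_ns (h12 : e₁ ≠ e₂) (h13 : e₁ ≠ e₃) (h23 : e₂ ≠ e₃) {x y : ℚ}
    (h : y ^ 2 = (x - e₁) * (x - e₂) * (x - e₃)) : (crv e₁ e₂ e₃).Nonsingular x y := by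
  have hΔ : (crv e₁ e₂ e₃).Δ ≠ 0 := by
    have : (crv e₁ e₂ e₃).Δ = 16 * (((e₁ : ℚ) - e₂) * (e₁ - e₃) * (e₂ - e₃)) ^ 2 := by
      simp only [crv, WeierstrassCurve.Δ, WeierstrassCurve.b₂, WeierstrassCurve.b₄,
        WeierstrassCurve.b₆, WeierstrassCurve.b₈]
      ring
    rw [this]
    have a1 : ((e₁ : ℚ) - e₂) ≠ 0 := sub_ne_zero.mpr (by exact_mod_cast h12)
    have a2 : ((e₁ : ℚ) - e₃) ≠ 0 := sub_ne_zero.mpr (by exact_mod_cast h13)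
    have a3 : ((e₂ : ℚ) - e₃) ≠ 0 := sub_ne_zero.mpr (by exact_mod_cast h23)
    positivity
  exact (equation_iff_nonsingular_of_Δ_ne_zero hΔ).mp (crv_eqn.mpr h)

theorem crv_eq_of_ns {x y : ℚ} (h : (crv e₁ e₂ e₃).Nonsingular x y) :
    y ^ 2 = (x - e₁) * (x - e₂) * (x - e₃) := crv_eqn.mp h.1

theorem crv_negY (x y : ℚ) : (crv e₁ e₂ e₃).negY x y = -y := by
  simp [WeierstrassCurve.Affine.negY, crv]

theorem crv_add_ne {x₁ y₁ x₂ y₂ : ℚ} (h₁ : (crv e₁ e₂ e₃).Nonsingular x₁ y₁)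
    (h₂ : (crv e₁ e₂ e₃).Nonsingular x₂ y₂) (hx : x₁ ≠ x₂) :
    ∃ y₃ h₃, Point.some x₁ y₁ h₁ + Point.some x₂ y₂ h₂ =
      Point.some (W' := crv e₁ e₂ e₃)
        (((y₁ - y₂) / (x₁ - x₂)) ^ 2 + (e₁ + e₂ + e₃) - x₁ - x₂) y₃ h₃ := by
  have hs : (crv e₁ e₂ e₃).slope x₁ x₂ y₁ y₂ = (y₁ - y₂) / (x₁ - x₂) := slope_of_X_ne hx
  have hX : (crv e₁ e₂ e₃).addX x₁ x₂ ((crv e₁ e₂ e₃).slope x₁ x₂ y₁ y₂) =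
      ((y₁ - y₂) / (x₁ - x₂)) ^ 2 + (e₁ + e₂ + e₃) - x₁ - x₂ := by
    rw [hs]; simp only [addX, crv]; ring
  rw [Point.add_of_X_ne hx]
  simp only [← hX]
  exact ⟨_, nonsingular_add h₁ h₂ (fun hxy => hx hxy.1), rfl⟩

theorem crv_add_self {x y : ℚ} (h : (crv e₁ e₂ e₃).Nonsingular x y) (hy : y ≠ 0)
    (X Y : ℚ)
    (hX : X = (((x - e₁) * (x - e₂) + (x - e₁) * (x - e₃) + (x - e₂) * (x - e₃)) / (2 * y)) ^ 2
       + (e₁ + e₂ + e₃) - 2 * x)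
    (hY : Y = -((((x - e₁) * (x - e₂) + (x - e₁) * (x - e₃) + (x - e₂) * (x - e₃)) / (2 * y))
      * (X - x) + y)) :
    ∃ h₃, Point.some x y h + Point.some x y h = Point.some (W' := crv e₁ e₂ e₃) X Y h₃ := by
  have hyn : y ≠ (crv e₁ e₂ e₃).negY x y := by
    rw [crv_negY]; intro h; apply hy; linarith
  have hs : (crv e₁ e₂ e₃).slope x x y y =
      ((x - e₁) * (x - e₂) + (x - e₁) * (x - e₃) + (x - e₂) * (x - e₃)) / (2 * y) := by
    rw [slope_of_Y_ne rfl hyn, crv_negY]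
    simp only [crv]
    congr 1 <;> ring
  have hX' : (crv e₁ e₂ e₃).addX x x ((crv e₁ e₂ e₃).slope x x y y) = X := by
    rw [hs, hX]; simp only [addX, crv]; ring
  have hY' : (crv e₁ e₂ e₃).addY x x y ((crv e₁ e₂ e₃).slope x x y y) = Y := by
    rw [addY, crv_negY, negAddY, hX', hs, hY]
  rw [Point.add_self_of_Y_ne hyn]
  have hns := nonsingular_add h h (fun hxy => hyn hxy.2)
  rw [hX', hY'] at hns
  refine ⟨hns, ?_⟩
  simp only [hX', hY']

theorem crv_halve (h12 : e₁ ≠ e₂) (h13 : e₁ ≠ e₃) (h23 : e₂ ≠ e₃) {x y : ℚ}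
    (h : (crv e₁ e₂ e₃).Nonsingular x y) (s₁ s₂ s₃ : ℚ)
    (h1 : x - e₁ = s₁ ^ 2) (h2 : x - e₂ = s₂ ^ 2) (h3 : x - e₃ = s₃ ^ 2) :
    ∃ U : (crv e₁ e₂ e₃).Point, Point.some x y h = U + U := by
  obtain ⟨r₁, r₂, r₃, h1, h2, h3, hy⟩ : ∃ r₁ r₂ r₃ : ℚ, x - e₁ = r₁ ^ 2 ∧ x - e₂ = r₂ ^ 2 ∧
      x - e₃ = r₃ ^ 2 ∧ y = r₁ * r₂ * r₃ := by
    have hy := crv_eq_of_ns h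
    rw [h1, h2, h3] at hy
    have : y ^ 2 = (s₁ * s₂ * s₃) ^ 2 := by rw [hy]; ring
    rcases sq_eq_sq_iff_eq_or_eq_neg.mp this with h' | h'
    · exact ⟨s₁, s₂, s₃, h1, h2, h3, h'⟩
    · exact ⟨-s₁, s₂, s₃, by rw [h1]; ring, h2, h3, by rw [h']; ring⟩
  have a12 : r₁ + r₂ ≠ 0 := by
    intro h0
    apply h12
    have : (e₁ : ℚ) = e₂ := by linear_combination h2 - h1 + (r₂ - r₁) * h0
    exact_mod_cast this
  have a13 : r₁ + r₃ ≠ 0 := by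
    intro h0
    apply h13
    have : (e₁ : ℚ) = e₃ := by linear_combination h3 - h1 + (r₃ - r₁) * h0
    exact_mod_cast this
  have a23 : r₂ + r₃ ≠ 0 := by
    intro h0
    apply h23
    have : (e₂ : ℚ) = e₃ := by linear_combination h3 - h2 + (r₃ - r₂) * h0
    exact_mod_cast this
  set u := x + r₁ * r₂ + r₁ * r₃ + r₂ * r₃ with hu
  set v := (r₁ + r₂) * (r₁ + r₃) * (r₂ + r₃) with hv
  have hv0 : v ≠ 0 := mul_ne_zero (mul_ne_zero a12 a13) a23
  have u1 : u - e₁ = (r₁ + r₂) * (r₁ + r₃) := by rw [hu]; linear_combination h1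
  have u2 : u - e₂ = (r₁ + r₂) * (r₂ + r₃) := by rw [hu]; linear_combination h2
  have u3 : u - e₃ = (r₁ + r₃) * (r₂ + r₃) := by rw [hu]; linear_combination h3
  have hns : (crv e₁ e₂ e₃).Nonsingular u v := by
    apply crv_ns h12 h13 h23
    rw [u1, u2, u3, hv]; ring
  have hsl : ((u - e₁) * (u - e₂) + (u - e₁) * (u - e₃) + (u - e₂) * (u - e₃)) / (2 * v)
      = r₁ + r₂ + r₃ := by
    rw [u1, u2, u3, div_eq_iff (mul_ne_zero two_ne_zero hv0), hv]
    ring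
  obtain ⟨h₃, hadd⟩ := crv_add_self hns hv0 x y
    (by rw [hsl, hu]; linear_combination h1 + h2 + h3)
    (by rw [hsl, hu, hv, hy]; ring)
  exact ⟨_, hadd.symm⟩

theorem crv_cubic {x₁ y₁ x₂ y₂ l x₃ e e' e'' : ℚ} (h₁ : y₁ ^ 2 = (x₁ - e) * (x₁ - e') * (x₁ - e''))
    (h₂ : y₂ ^ 2 = (x₂ - e) * (x₂ - e') * (x₂ - e'')) (hx : x₁ ≠ x₂)
    (hl : l * (x₁ - x₂) = y₁ - y₂) (hx₃ : x₃ = l ^ 2 + (e + e' + e'') - x₁ - x₂) :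
    (x₁ - e) * (x₂ - e) * (x₃ - e) = (y₁ + l * (e - x₁)) ^ 2 := by
  have hy₁ : y₂ = y₁ - l * (x₁ - x₂) := by linarith
  subst hx₃
  subst hy₁
  apply mul_left_cancel₀ (sub_ne_zero.mpr hx)
  linear_combination (x₂ - e) * h₁ - (x₁ - e) * h₂
end Crv


theorem nat_sq_of_even (n : ℕ) (hn : n ≠ 0) (h : ∀ p, p.Prime → Even (n.factorization p)) :
    IsSquare n := by
  have h1 := Nat.prod_factorization_pow_eq_self hn
  rw [Finsupp.prod, Nat.support_factorization] at h1
  refine ⟨∏ p ∈ n.primeFactors, p ^ (n.factorization p / 2), ?_⟩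
  rw [← Finset.prod_mul_distrib]
  conv_lhs => rw [← h1]
  apply Finset.prod_congr rfl
  intro p hp
  rw [← pow_add]
  congr 1
  obtain ⟨k, hk⟩ := h p (Nat.prime_of_mem_primeFactors hp)
  omega

theorem rat_int_of_sq (q : ℚ) (n : ℤ) (h : q ^ 2 = n) : ∃ z : ℤ, q = z := by
  have h1 : (q ^ 2).den = q.den ^ 2 := Rat.den_pow q 2
  rw [h, Rat.den_intCast] at h1
  have h2 : q.den = 1 := by
    have := h1.symm
    simpa using this
  exact ⟨q.num, (Rat.den_eq_one_iff q).mp h2 |>.symm⟩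

/-- Class of an integer modulo squares, seen by a finite set of primes. -/
def icls (S : Finset ℕ) (u : ℤ) : Bool × ({p // p ∈ S} → Bool) :=
  (decide (0 < u), fun p => decide (Even (u.natAbs.factorization p.1)))

theorem icls_sq (S : Finset ℕ) (u v : ℤ) (hu : u ≠ 0) (hv : v ≠ 0)
    (hu' : ∀ p : ℕ, p.Prime → p ∉ S → Even (u.natAbs.factorization p))
    (hv' : ∀ p : ℕ, p.Prime → p ∉ S → Even (v.natAbs.factorization p))
    (h : icls S u = icls S v) : ∃ w : ℤ, u * v = w ^ 2 := by
  unfold icls at h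
  rw [Prod.mk.injEq] at h
  obtain ⟨h1, h2⟩ := h
  have hpos : 0 < u * v := by
    rw [decide_eq_decide] at h1
    rcases lt_or_gt_of_ne hu with h3 | h3
    · have : v < 0 := by
        rcases lt_or_gt_of_ne hv with h4 | h4
        · exact h4
        · have := h1.mpr h4; omega
      exact mul_pos_of_neg_of_neg h3 this
    · exact mul_pos h3 (h1.mp h3)
  have hsq : IsSquare (u * v).natAbs := by
    apply nat_sq_of_even
    · exact Int.natAbs_ne_zero.mpr hpos.ne'
    · intro p hp
      rw [Int.natAbs_mul, Nat.factorization_mul (Int.natAbs_ne_zero.mpr hu)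
        (Int.natAbs_ne_zero.mpr hv), Finsupp.add_apply]
      by_cases hpS : p ∈ S
      · have := congrFun h2 ⟨p, hpS⟩
        rw [decide_eq_decide] at this
        rw [Nat.even_add]
        exact this
      · exact (hu' p hp hpS).add (hv' p hp hpS)
  obtain ⟨w, hw⟩ := hsq
  refine ⟨w, ?_⟩
  have : ((u * v).natAbs : ℤ) = u * v := Int.natAbs_of_nonneg hpos.le
  rw [← this, hw]; push_cast; ring

section data
variable {e₁ e₂ e₃ : ℤ}

theorem pt_int_data {x y : ℚ} (h : y ^ 2 = (x - e₁) * (x - e₂) * (x - e₃)) :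
    ∃ Z : ℤ, (Z : ℚ) = y * (x.den : ℚ) ^ 2 ∧ Z ^ 2 = x.den * ((x.num - e₁ * x.den) *
      (x.num - e₂ * x.den) * (x.num - e₃ * x.den)) := by
  have hB : (x.den : ℚ) ≠ 0 := by exact_mod_cast x.den_nz
  have hx : x = x.num / x.den := (Rat.num_div_den x).symm
  set A : ℤ := x.num
  set B : ℕ := x.den
  have h1 : (y * (B : ℚ) ^ 2) ^ 2 = ((B * ((A - e₁ * B) *
      (A - e₂ * B) * (A - e₃ * B)) : ℤ) : ℚ) := by
    rw [mul_pow, h, hx]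
    push_cast
    field_simp
  obtain ⟨Z, hZ⟩ := rat_int_of_sq _ _ h1
  refine ⟨Z, hZ.symm, ?_⟩
  rw [hZ] at h1
  exact_mod_cast h1

theorem pt_den_sq {x y : ℚ} (h : y ^ 2 = (x - e₁) * (x - e₂) * (x - e₃)) :
    ∃ b : ℤ, (x.den : ℤ) = b ^ 2 := by
  obtain ⟨Z, -, hZ⟩ := pt_int_data h
  have hc : ∀ e : ℤ, IsCoprime (x.den : ℤ) (x.num - e * x.den) := by
    intro e
    have h0 : IsCoprime (x.den : ℤ) x.num := by
      rw [Int.isCoprime_iff_gcd_eq_one, Int.gcd_comm]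
      exact x.reduced
    have := h0.add_mul_left_right (-e)
    have e1 : x.num - e * x.den = x.num + x.den * (-e) := by ring
    rw [e1]; exact this
  have hc3 : IsCoprime (x.den : ℤ) ((x.num - e₁ * x.den) *
      (x.num - e₂ * x.den) * (x.num - e₃ * x.den)) :=
    ((hc e₁).mul_right (hc e₂)).mul_right (hc e₃)
  obtain ⟨b, hb | hb⟩ := Int.sq_of_isCoprime hc3 hZ.symm
  · exact ⟨b, hb⟩
  · exfalso
    have h1 : 0 < (x.den : ℤ) := by exact_mod_cast x.den_pos
    nlinarith [sq_nonneg b]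

theorem even_aux (A B u e f g Z : ℤ) (hB : 0 < B) (hcop : IsCoprime B A)
    (hu : u = A - e * B) (hZ : Z ^ 2 = B * (u * (A - f * B) * (A - g * B)))
    (h0 : u ≠ 0) (p : ℕ) (hp : p.Prime)
    (hf0 : A - f * B ≠ 0) (hg0 : A - g * B ≠ 0)
    (hpf : ¬ (p : ℤ) ∣ e - f) (hpg : ¬ (p : ℤ) ∣ e - g) :
    Even (u.natAbs.factorization p) := by
  have hpz : Prime (p : ℤ) := Nat.prime_iff_prime_int.mp hp
  by_cases hpu : (p : ℤ) ∣ u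
  · have hpB : ¬ (p : ℤ) ∣ B := by
      intro hpB
      have : (p : ℤ) ∣ A := by
        have e1 : A = u + e * B := by rw [hu]; ring
        rw [e1]; exact dvd_add hpu (hpB.mul_left e)
      exact hpz.not_isUnit (hcop.isUnit_of_dvd' hpB this)
    have aux : ∀ f : ℤ, ¬ (p : ℤ) ∣ e - f → ¬ (p : ℤ) ∣ A - f * B := by
      intro f hf h1
      have h2 := dvd_sub h1 hpu
      have e1 : A - f * B - u = (e - f) * B := by rw [hu]; ring
      rw [e1] at h2
      rcases hpz.dvd_or_dvd h2 with h3 | h3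
      · exact hf h3
      · exact hpB h3
    have hW : ¬ (p : ℤ) ∣ B * ((A - f * B) * (A - g * B)) := by
      intro h1
      rcases hpz.dvd_or_dvd h1 with h3 | h3
      · exact hpB h3
      · rcases hpz.dvd_or_dvd h3 with h4 | h4
        · exact aux f hpf h4
        · exact aux g hpg h4
    set W := B * ((A - f * B) * (A - g * B)) with hWd
    have hW0 : W ≠ 0 := mul_ne_zero hB.ne' (mul_ne_zero hf0 hg0)
    have hZ' : Z ^ 2 = u * W := by rw [hZ, hWd]; ring
    have h3 := congrArg (fun z : ℤ => z.natAbs.factorization p) hZ'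
    simp only [Int.natAbs_pow, Int.natAbs_mul] at h3
    rw [Nat.factorization_pow, Nat.factorization_mul (Int.natAbs_ne_zero.mpr h0)
      (Int.natAbs_ne_zero.mpr hW0), Finsupp.add_apply, Finsupp.smul_apply,
      Nat.factorization_eq_zero_of_not_dvd (n := W.natAbs)
        (fun h => hW (Int.natCast_dvd.mpr h)), add_zero] at h3
    rw [← h3]
    simp
  · rw [Nat.factorization_eq_zero_of_not_dvd (fun h => hpu (Int.natCast_dvd.mpr h))]
    simp

open WeierstrassCurve.Affine

/-- Primes of bad reduction. -/
def badP (e₁ e₂ e₃ : ℤ) : Finset ℕ := ((e₁ - e₂) * (e₁ - e₃) * (e₂ - e₃)).natAbs.primeFactors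

/-- Target of the `2`-descent map. -/
abbrev DescT (e₁ e₂ e₃ : ℤ) : Type :=
  Fin 4 ⊕ ((Bool × ({p // p ∈ badP e₁ e₂ e₃} → Bool)) × (Bool × ({p // p ∈ badP e₁ e₂ e₃} → Bool)))

/-- The `2`-descent map. -/
def descMap (e₁ e₂ e₃ : ℤ) : (crv e₁ e₂ e₃).Point → DescT e₁ e₂ e₃
  | .zero => Sum.inl 0
  | .some x _ _ =>
    if x = e₁ then Sum.inl 1 else if x = e₂ then Sum.inl 2 else if x = e₃ then Sum.inl 3 else
    Sum.inr (icls (badP e₁ e₂ e₃) (x.num - e₁ * x.den), icls (badP e₁ e₂ e₃) (x.num - e₂ * x.den))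

theorem descT_card : Fintype.card (DescT e₁ e₂ e₃) = 4 + (2 * 2 ^ (badP e₁ e₂ e₃).card) ^ 2 := by
  simp [DescT, sq]

theorem desc_arith (h12 : e₁ ≠ e₂) (h13 : e₁ ≠ e₃) (h23 : e₂ ≠ e₃) {x₁ y₁ x₂ y₂ : ℚ}
    (E₁ : y₁ ^ 2 = (x₁ - e₁) * (x₁ - e₂) * (x₁ - e₃))
    (E₂ : y₂ ^ 2 = (x₂ - e₁) * (x₂ - e₂) * (x₂ - e₃))
    (n11 : x₁ ≠ e₁) (n12 : x₁ ≠ e₂) (n13 : x₁ ≠ e₃)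
    (n21 : x₂ ≠ e₁) (n22 : x₂ ≠ e₂) (n23 : x₂ ≠ e₃)
    (k1 : icls (badP e₁ e₂ e₃) (x₁.num - e₁ * x₁.den) = icls (badP e₁ e₂ e₃) (x₂.num - e₁ * x₂.den))
    (k2 : icls (badP e₁ e₂ e₃) (x₁.num - e₂ * x₁.den) =
      icls (badP e₁ e₂ e₃) (x₂.num - e₂ * x₂.den)) :
    ∃ t₁ t₂ t₃ : ℚ, t₁ ≠ 0 ∧ t₂ ≠ 0 ∧ t₃ ≠ 0 ∧ (x₁ - e₁) * (x₂ - e₁) = t₁ ^ 2 ∧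
      (x₁ - e₂) * (x₂ - e₂) = t₂ ^ 2 ∧ (x₁ - e₃) * (x₂ - e₃) = t₃ ^ 2 := by
  have hu : ∀ (x : ℚ) (e : ℤ), x - e = ((x.num - e * x.den : ℤ) : ℚ) / x.den := by
    intro x e
    have hB : (x.den : ℚ) ≠ 0 := by exact_mod_cast x.den_nz
    rw [eq_div_iff hB, sub_mul, Rat.mul_den_eq_num]
    push_cast; ring
  have hu0 : ∀ (x : ℚ) (e : ℤ), x ≠ e → x.num - e * x.den ≠ 0 := by
    intro x e hne h0
    apply hne
    have := hu x e
    rw [h0] at this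
    simp at this
    linarith
  have hbad : ∀ p : ℕ, p.Prime → p ∉ badP e₁ e₂ e₃ → ¬ (p : ℤ) ∣ e₁ - e₂ ∧ ¬ (p : ℤ) ∣ e₁ - e₃ ∧
      ¬ (p : ℤ) ∣ e₂ - e₃ := by
    intro p hp hpS
    have hn : ¬ (p : ℤ) ∣ (e₁ - e₂) * (e₁ - e₃) * (e₂ - e₃) := by
      intro hd
      apply hpS
      unfold badP
      rw [Nat.mem_primeFactors]
      refine ⟨hp, Int.natCast_dvd.mp hd, ?_⟩
      rw [Int.natAbs_ne_zero]
      exact mul_ne_zero (mul_ne_zero (sub_ne_zero.mpr h12) (sub_ne_zero.mpr h13))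
        (sub_ne_zero.mpr h23)
    refine ⟨fun h => hn ?_, fun h => hn ?_, fun h => hn ?_⟩
    · exact (h.mul_right _).mul_right _
    · exact (h.mul_left _).mul_right _
    · exact h.mul_left _
  have heven : ∀ (x y : ℚ), y ^ 2 = (x - e₁) * (x - e₂) * (x - e₃) → x ≠ e₁ → x ≠ e₂ → x ≠ e₃ →
      ∀ p : ℕ, p.Prime → p ∉ badP e₁ e₂ e₃ →
      Even ((x.num - e₁ * x.den).natAbs.factorization p) ∧
      Even ((x.num - e₂ * x.den).natAbs.factorization p) := by
    intro x y hE m1 m2 m3 p hp hpS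
    obtain ⟨b12, b13, b23⟩ := hbad p hp hpS
    obtain ⟨Z, -, hZ⟩ := pt_int_data hE
    have hB : 0 < (x.den : ℤ) := by exact_mod_cast x.den_pos
    have hc : IsCoprime (x.den : ℤ) x.num := by
      rw [Int.isCoprime_iff_gcd_eq_one, Int.gcd_comm]
      exact x.reduced
    constructor
    · exact even_aux x.num x.den _ e₁ e₂ e₃ Z hB hc rfl hZ (hu0 x e₁ m1) p hp
        (hu0 x e₂ m2) (hu0 x e₃ m3) b12 b13
    · refine even_aux x.num x.den _ e₂ e₁ e₃ Z hB hc rfl (by rw [hZ]; ring) (hu0 x e₂ m2) p hp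
        (hu0 x e₁ m1) (hu0 x e₃ m3) ?_ b23
      rwa [dvd_sub_comm]
  obtain ⟨w₁, hw₁⟩ := icls_sq _ _ _ (hu0 x₁ e₁ n11) (hu0 x₂ e₁ n21)
    (fun p hp hpS => (heven x₁ y₁ E₁ n11 n12 n13 p hp hpS).1)
    (fun p hp hpS => (heven x₂ y₂ E₂ n21 n22 n23 p hp hpS).1) k1
  obtain ⟨w₂, hw₂⟩ := icls_sq _ _ _ (hu0 x₁ e₂ n12) (hu0 x₂ e₂ n22)
    (fun p hp hpS => (heven x₁ y₁ E₁ n11 n12 n13 p hp hpS).2)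
    (fun p hp hpS => (heven x₂ y₂ E₂ n21 n22 n23 p hp hpS).2) k2
  obtain ⟨b₁, hb₁⟩ := pt_den_sq E₁
  obtain ⟨b₂, hb₂⟩ := pt_den_sq E₂
  have hsq : ∀ (e w : ℤ), (x₁.num - e * x₁.den) * (x₂.num - e * x₂.den) = w ^ 2 →
      (x₁ - e) * (x₂ - e) = (w / (b₁ * b₂) : ℚ) ^ 2 := by
    intro e w hw
    rw [hu x₁ e, hu x₂ e, div_mul_div_comm]
    have c1 : (x₁.den : ℚ) = (b₁ : ℚ) ^ 2 := by exact_mod_cast hb₁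
    have c2 : (x₂.den : ℚ) = (b₂ : ℚ) ^ 2 := by exact_mod_cast hb₂
    rw [c1, c2, div_pow, mul_pow]
    congr 1
    exact_mod_cast hw
  set t₁ : ℚ := w₁ / (b₁ * b₂) with ht₁
  set t₂ : ℚ := w₂ / (b₁ * b₂) with ht₂
  have q₁ : (x₁ - e₁) * (x₂ - e₁) = t₁ ^ 2 := hsq e₁ w₁ hw₁
  have q₂ : (x₁ - e₂) * (x₂ - e₂) = t₂ ^ 2 := hsq e₂ w₂ hw₂
  have ht₁0 : t₁ ≠ 0 := by
    intro h0; rw [h0] at q₁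
    exact mul_ne_zero (sub_ne_zero.mpr n11) (sub_ne_zero.mpr n21) (by simpa using q₁)
  have ht₂0 : t₂ ≠ 0 := by
    intro h0; rw [h0] at q₂
    exact mul_ne_zero (sub_ne_zero.mpr n12) (sub_ne_zero.mpr n22) (by simpa using q₂)
  have q₃ : (x₁ - e₃) * (x₂ - e₃) = (y₁ * y₂ / (t₁ * t₂)) ^ 2 := by
    rw [div_pow, eq_div_iff (pow_ne_zero 2 (mul_ne_zero ht₁0 ht₂0)), mul_pow, mul_pow, ← q₁, ← q₂,
      E₁, E₂]
    ring
  set t₃ : ℚ := y₁ * y₂ / (t₁ * t₂) with ht₃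
  have ht₃0 : t₃ ≠ 0 := by
    intro h0; rw [h0] at q₃
    exact mul_ne_zero (sub_ne_zero.mpr n13) (sub_ne_zero.mpr n23) (by simpa using q₃)
  exact ⟨t₁, t₂, t₃, ht₁0, ht₂0, ht₃0, q₁, q₂, q₃⟩

theorem desc_arith2 {x₁ y₁ x₂ y₂ e₁ e₂ e₃ : ℚ}
    (E₁ : y₁ ^ 2 = (x₁ - e₁) * (x₁ - e₂) * (x₁ - e₃))
    (E₂ : y₂ ^ 2 = (x₂ - e₁) * (x₂ - e₂) * (x₂ - e₃)) (hx : x₁ ≠ x₂) {t₁ t₂ t₃ : ℚ}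
    (ht₁0 : t₁ ≠ 0) (ht₂0 : t₂ ≠ 0) (ht₃0 : t₃ ≠ 0) (q₁ : (x₁ - e₁) * (x₂ - e₁) = t₁ ^ 2)
    (q₂ : (x₁ - e₂) * (x₂ - e₂) = t₂ ^ 2) (q₃ : (x₁ - e₃) * (x₂ - e₃) = t₃ ^ 2) (x₃ : ℚ)
    (hx₃ : x₃ = ((y₁ - y₂) / (x₁ - x₂)) ^ 2 + (e₁ + e₂ + e₃) - x₁ - x₂) :
    ∃ s₁ s₂ s₃ : ℚ, x₃ - e₁ = s₁ ^ 2 ∧ x₃ - e₂ = s₂ ^ 2 ∧ x₃ - e₃ = s₃ ^ 2 := by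
  obtain ⟨l, hl⟩ : ∃ l : ℚ, l = (y₁ - y₂) / (x₁ - x₂) := ⟨_, rfl⟩
  rw [← hl] at hx₃
  have hl' : l * (x₁ - x₂) = y₁ - y₂ := by
    rw [hl]; exact div_mul_cancel₀ _ (sub_ne_zero.mpr hx)
  have hfin : ∀ (e t m : ℚ), t ≠ 0 → (x₁ - e) * (x₂ - e) = t ^ 2 →
      (x₁ - e) * (x₂ - e) * (x₃ - e) = m ^ 2 → x₃ - e = (m / t) ^ 2 := by
    intro e t m ht h1 h2
    rw [div_pow, eq_div_iff (pow_ne_zero 2 ht), ← h2, ← h1]; ring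
  have c₁ := hfin e₁ t₁ _ ht₁0 q₁ (crv_cubic E₁ E₂ hx hl' hx₃)
  have c₂ := hfin e₂ t₂ _ ht₂0 q₂ (crv_cubic (e' := e₁) (e'' := e₃) (by rw [E₁]; ring)
    (by rw [E₂]; ring) hx hl' (by rw [hx₃]; ring))
  have c₃ := hfin e₃ t₃ _ ht₃0 q₃ (crv_cubic (e' := e₁) (e'' := e₂) (by rw [E₁]; ring)
    (by rw [E₂]; ring) hx hl' (by rw [hx₃]; ring))
  exact ⟨_, _, _, c₁, c₂, c₃⟩

theorem crv_neg {x₂ y₂ : ℚ} (h₂ : (crv e₁ e₂ e₃).Nonsingular x₂ y₂) :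
    ∃ h₂' : (crv e₁ e₂ e₃).Nonsingular x₂ (-y₂),
      -Point.some x₂ y₂ h₂ = Point.some x₂ (-y₂) h₂' := by
  have h₂' : (crv e₁ e₂ e₃).Nonsingular x₂ (-y₂) := by
    have := (nonsingular_neg x₂ y₂).mpr h₂
    rwa [crv_negY] at this
  refine ⟨h₂', ?_⟩
  rw [Point.neg_some]
  simp only [crv_negY]

theorem desc_generic (h12 : e₁ ≠ e₂) (h13 : e₁ ≠ e₃) (h23 : e₂ ≠ e₃) {x₁ y₁ x₂ y₂ : ℚ}
    (h₁ : (crv e₁ e₂ e₃).Nonsingular x₁ y₁) (h₂ : (crv e₁ e₂ e₃).Nonsingular x₂ y₂)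
    (hx : x₁ ≠ x₂) (n11 : x₁ ≠ e₁) (n12 : x₁ ≠ e₂) (n13 : x₁ ≠ e₃)
    (n21 : x₂ ≠ e₁) (n22 : x₂ ≠ e₂) (n23 : x₂ ≠ e₃)
    (k1 : icls (badP e₁ e₂ e₃) (x₁.num - e₁ * x₁.den) = icls (badP e₁ e₂ e₃) (x₂.num - e₁ * x₂.den))
    (k2 : icls (badP e₁ e₂ e₃) (x₁.num - e₂ * x₁.den) =
      icls (badP e₁ e₂ e₃) (x₂.num - e₂ * x₂.den)) :
    ∃ U, Point.some x₁ y₁ h₁ - Point.some x₂ y₂ h₂ = U + U := by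
  have E₁ := crv_eq_of_ns h₁
  have E₂ := crv_eq_of_ns h₂
  obtain ⟨t₁, t₂, t₃, ht₁0, ht₂0, ht₃0, q₁, q₂, q₃⟩ :=
    desc_arith h12 h13 h23 E₁ E₂ n11 n12 n13 n21 n22 n23 k1 k2
  obtain ⟨h₂', hneg⟩ := crv_neg h₂
  obtain ⟨y₃, h₃, hadd⟩ := crv_add_ne h₁ h₂' hx
  obtain ⟨s₁, s₂, s₃, c₁, c₂, c₃⟩ := desc_arith2 E₁ (crv_eq_of_ns h₂') hx ht₁0 ht₂0 ht₃0 q₁ q₂ q₃ _ rfl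
  obtain ⟨U, hU⟩ := crv_halve h12 h13 h23 h₃ _ _ _ c₁ c₂ c₃
  refine ⟨U, ?_⟩
  rw [← hU, ← hadd, ← hneg]
  exact sub_eq_add_neg _ _

theorem descMap_zero : descMap e₁ e₂ e₃ 0 = Sum.inl 0 := rfl

theorem descMap_some {x y : ℚ} (h : (crv e₁ e₂ e₃).Nonsingular x y) :
    descMap e₁ e₂ e₃ (Point.some x y h) =
    if x = e₁ then Sum.inl 1 else if x = e₂ then Sum.inl 2 else if x = e₃ then Sum.inl 3 else
    Sum.inr (icls (badP e₁ e₂ e₃) (x.num - e₁ * x.den), icls (badP e₁ e₂ e₃) (x.num - e₂ * x.den)) :=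
  rfl

theorem descMap_some_ne {x y : ℚ} (h : (crv e₁ e₂ e₃).Nonsingular x y) :
    descMap e₁ e₂ e₃ (Point.some x y h) ≠ Sum.inl 0 := by
  rw [descMap_some]
  split_ifs <;> simp

theorem descMap_spec (h12 : e₁ ≠ e₂) (h13 : e₁ ≠ e₃) (h23 : e₂ ≠ e₃)
    (P Q : (crv e₁ e₂ e₃).Point) (h : descMap e₁ e₂ e₃ P = descMap e₁ e₂ e₃ Q) :
    ∃ U, P - Q = U + U := by
  have htriv : P = Q → ∃ U, P - Q = U + U := fun h => ⟨0, by rw [h]; simp⟩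
  have htriv2 : P = -Q → ∃ U, P - Q = U + U := fun h => ⟨P, by
    rw [sub_eq_add_neg, ← h]⟩
  rcases P with _ | ⟨x₁, y₁, h₁⟩ <;> rcases Q with _ | ⟨x₂, y₂, h₂⟩
  · exact htriv rfl
  · exact absurd h.symm (descMap_some_ne h₂)
  · exact absurd h (descMap_some_ne h₁)
  by_cases hx : x₁ = x₂
  · subst hx
    have : y₁ ^ 2 = y₂ ^ 2 := by rw [crv_eq_of_ns h₁, crv_eq_of_ns h₂]
    rcases sq_eq_sq_iff_eq_or_eq_neg.mp this with h' | h'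
    · subst h'; exact htriv rfl
    · apply htriv2
      rw [Point.neg_some]
      simp only [crv_negY, h']
  rw [descMap_some, descMap_some] at h
  by_cases n11 : x₁ = e₁
  · rw [if_pos n11] at h
    have : x₂ ≠ e₁ := fun h => hx (n11.trans h.symm)
    rw [if_neg this] at h
    exfalso
    split_ifs at h <;> simp at h
  rw [if_neg n11] at h
  by_cases n12 : x₁ = e₂
  · rw [if_pos n12] at h
    have : x₂ ≠ e₂ := fun h => hx (n12.trans h.symm)
    rw [if_neg this] at h
    exfalso
    split_ifs at h <;> simp at h
  rw [if_neg n12] at h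
  by_cases n13 : x₁ = e₃
  · rw [if_pos n13] at h
    have : x₂ ≠ e₃ := fun h => hx (n13.trans h.symm)
    rw [if_neg this] at h
    exfalso
    split_ifs at h <;> simp at h
  rw [if_neg n13] at h
  by_cases n21 : x₂ = e₁
  · rw [if_pos n21] at h; simp at h
  rw [if_neg n21] at h
  by_cases n22 : x₂ = e₂
  · rw [if_pos n22] at h; simp at h
  rw [if_neg n22] at h
  by_cases n23 : x₂ = e₃
  · rw [if_pos n23] at h; simp at h
  rw [if_neg n23, Sum.inr.injEq, Prod.mk.injEq] at h
  exact desc_generic h12 h13 h23 h₁ h₂ hx n11 n12 n13 n21 n22 n23 h.1 h.2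
end data


/-- Height of a rational number. -/
def Hq (x : ℚ) : ℕ := max x.num.natAbs x.den

theorem Hq_num (x : ℚ) : |x.num| ≤ (Hq x : ℤ) := by
  rw [Int.abs_eq_natAbs]; exact_mod_cast le_max_left _ _

theorem Hq_den (x : ℚ) : (x.den : ℤ) ≤ (Hq x : ℤ) := by
  exact_mod_cast le_max_right _ _

theorem Hq_pos (x : ℚ) : 1 ≤ (Hq x : ℤ) := by
  have := Hq_den x
  have := x.den_pos
  omega

theorem Hq_le {x : ℚ} (a b M : ℤ) (hb : b ≠ 0) (h : x * b = a) (ha : |a| ≤ M) (hbM : |b| ≤ M) :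
    (Hq x : ℤ) ≤ M := by
  have hb' : (b : ℚ) ≠ 0 := by exact_mod_cast hb
  have hx : x = (a : ℚ) / b := by rw [eq_div_iff hb']; exact h
  have hbpos : 0 < |b| := abs_pos.mpr hb
  have h1 : (x.den : ℤ) ≤ M := by
    have hd : (x.den : ℤ) ∣ b := by rw [hx]; exact_mod_cast Rat.den_dvd a b
    exact (Int.le_of_dvd hbpos ((dvd_abs _ _).mpr hd)).trans hbM
  have h2 : |x.num| ≤ M := by
    by_cases h0 : a = 0
    · have : x = 0 := by rw [hx, h0]; simp
      rw [this]; simp; omega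
    · have hd : x.num ∣ a := by rw [hx, ← Rat.divInt_eq_div]; exact Rat.num_dvd a hb
      exact (Int.le_of_dvd (abs_pos.mpr h0) ((abs_dvd_abs _ _).mpr hd)).trans ha
  unfold Hq
  push_cast
  exact max_le h2 h1

theorem lin_bd {A B e m H : ℤ} (hA : |A| ≤ H) (hB : |B| ≤ H) (he : |e| ≤ m) (hm : 1 ≤ m) :
    |A - e * B| ≤ 2 * m * H := by
  have hH : 0 ≤ H := (abs_nonneg _).trans hA
  calc |A - e * B| ≤ |A| + |e * B| := abs_sub _ _
    _ = |A| + |e| * |B| := by rw [abs_mul]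
    _ ≤ H + m * H := by
      gcongr
    _ ≤ 2 * m * H := by nlinarith

theorem prod_bd {a b A B : ℤ} (ha : |a| ≤ A) (hb : |b| ≤ B) : |a * b| ≤ A * B := by
  rw [abs_mul]
  exact mul_le_mul ha hb (abs_nonneg _) ((abs_nonneg _).trans ha)

theorem sum_bd {a b A B : ℤ} (ha : |a| ≤ A) (hb : |b| ≤ B) : |a + b| ≤ A + B :=
  (abs_add_le _ _).trans (add_le_add ha hb)

theorem diff_bd {a b A B : ℤ} (ha : |a| ≤ A) (hb : |b| ≤ B) : |a - b| ≤ A + B :=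
  (abs_sub _ _).trans (add_le_add ha hb)

theorem mpow_le {m : ℤ} (hm : 1 ≤ m) {i j : ℕ} (h : i ≤ j) : m ^ i ≤ m ^ j :=
  pow_le_pow_right₀ hm h

theorem Z_bd {A B Z e₁ e₂ e₃ m H : ℤ} (hA : |A| ≤ H) (hB : |B| ≤ H) (h1 : |e₁| ≤ m)
    (h2 : |e₂| ≤ m) (h3 : |e₃| ≤ m) (hm : 1 ≤ m)
    (hZ : Z ^ 2 = B * ((A - e₁ * B) * (A - e₂ * B) * (A - e₃ * B))) : |Z| ≤ 3 * m ^ 2 * H ^ 2 := by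
  have hH : 0 ≤ H := (abs_nonneg _).trans hA
  have h := prod_bd hB (prod_bd (prod_bd (lin_bd hA hB h1 hm) (lin_bd hA hB h2 hm))
    (lin_bd hA hB h3 hm))
  rw [← hZ] at h
  apply abs_le_of_sq_le_sq _ (by positivity)
  calc Z ^ 2 ≤ |Z ^ 2| := le_abs_self _
    _ ≤ _ := h
    _ = 8 * m ^ 3 * H ^ 4 := by ring
    _ ≤ 9 * m ^ 4 * H ^ 4 := by
      have := mpow_le hm (show 3 ≤ 4 by norm_num)
      gcongr; norm_num
    _ = _ := by ring

theorem add_num_bd {A₁ B₁ A₂ B₂ Z₁ Z₂ e₁ e₂ e₃ m H₁ H₂ : ℤ} (hA₁ : |A₁| ≤ H₁) (hB₁ : |B₁| ≤ H₁)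
    (hA₂ : |A₂| ≤ H₂) (hB₂ : |B₂| ≤ H₂) (h1 : |e₁| ≤ m)
    (h2 : |e₂| ≤ m) (h3 : |e₃| ≤ m) (hm : 1 ≤ m)
    (hZ₁ : |Z₁| ≤ 3 * m ^ 2 * H₁ ^ 2) (hZ₂ : |Z₂| ≤ 3 * m ^ 2 * H₂ ^ 2) :
    |(A₁ * B₂ + A₂ * B₁) * ((e₁ * e₂ + e₁ * e₃ + e₂ * e₃) * (B₁ * B₂) + A₁ * A₂)
      - 2 * ((e₁ + e₂ + e₃) * ((A₁ * A₂) * (B₁ * B₂))) - 2 * ((e₁ * e₂ * e₃) * ((B₁ * B₂) * (B₁ * B₂)))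
      - 2 * (Z₁ * Z₂)| ≤ 34 * m ^ 4 * H₁ ^ 2 * H₂ ^ 2 := by
  have hH₁ : 0 ≤ H₁ := (abs_nonneg _).trans hA₁
  have hH₂ : 0 ≤ H₂ := (abs_nonneg _).trans hA₂
  have two : |(2 : ℤ)| ≤ 2 := by norm_num
  have h := diff_bd (diff_bd (diff_bd (prod_bd (sum_bd (prod_bd hA₁ hB₂) (prod_bd hA₂ hB₁))
    (sum_bd (prod_bd (sum_bd (sum_bd (prod_bd h1 h2) (prod_bd h1 h3)) (prod_bd h2 h3))
      (prod_bd hB₁ hB₂)) (prod_bd hA₁ hA₂)))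
    (prod_bd two (prod_bd (sum_bd (sum_bd h1 h2) h3) (prod_bd (prod_bd hA₁ hA₂) (prod_bd hB₁ hB₂)))))
    (prod_bd two (prod_bd (prod_bd (prod_bd h1 h2) h3)
      (prod_bd (prod_bd hB₁ hB₂) (prod_bd hB₁ hB₂)))))
    (prod_bd two (prod_bd hZ₁ hZ₂))
  refine h.trans ?_
  have a0 := mpow_le hm (show 0 ≤ 4 by norm_num)
  have a1 := mpow_le hm (show 1 ≤ 4 by norm_num)
  have a2 := mpow_le hm (show 2 ≤ 4 by norm_num)
  have a3 := mpow_le hm (show 3 ≤ 4 by norm_num)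
  have key : 6 * m ^ 2 + 2 * m ^ 0 + 6 * m ^ 1 + 2 * m ^ 3 + 18 * m ^ 4 ≤ 34 * m ^ 4 := by linarith
  have hh : 0 ≤ H₁ ^ 2 * H₂ ^ 2 := by positivity
  have := mul_le_mul_of_nonneg_right key hh
  linarith

theorem dbl_bd {A B e₁ e₂ e₃ m H : ℤ} (hA : |A| ≤ H) (hB : |B| ≤ H) (h1 : |e₁| ≤ m)
    (h2 : |e₂| ≤ m) (h3 : |e₃| ≤ m) (hm : 1 ≤ m) :
    |4 * (B * ((A - e₁ * B) * (A - e₂ * B) * (A - e₃ * B)))| ≤ 96 * m ^ 4 * H ^ 4 ∧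
    |((A - e₁ * B) * (A - e₁ * B) - (e₁ - e₂) * (e₁ - e₃) * (B * B)) *
      ((A - e₁ * B) * (A - e₁ * B) - (e₁ - e₂) * (e₁ - e₃) * (B * B))
      + e₁ * (4 * (B * ((A - e₁ * B) * (A - e₂ * B) * (A - e₃ * B))))| ≤ 96 * m ^ 4 * H ^ 4 := by
  have hH : 0 ≤ H := (abs_nonneg _).trans hA
  have four : |(4 : ℤ)| ≤ 4 := by norm_num
  have g := prod_bd four (prod_bd hB (prod_bd (prod_bd (lin_bd hA hB h1 hm) (lin_bd hA hB h2 hm))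
    (lin_bd hA hB h3 hm)))
  have l := lin_bd hA hB h1 hm
  have n := diff_bd (prod_bd l l) (prod_bd (prod_bd (diff_bd h1 h2) (diff_bd h1 h3)) (prod_bd hB hB))
  have f := sum_bd (prod_bd n n) (prod_bd h1 g)
  have hh : 0 ≤ H ^ 4 := by positivity
  have a3 := mul_le_mul_of_nonneg_right (mpow_le hm (show 3 ≤ 4 by norm_num)) hh
  have a4 : 0 ≤ m ^ 4 * H ^ 4 := by positivity
  constructor
  · refine g.trans ?_
    linarith
  · refine f.trans ?_
    linarith

theorem dbl_lower {A B A' B' D e₁ e₂ e₃ m H' N₁ N₂ N₃ : ℤ} (hc : IsCoprime A B)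
    (h12 : e₁ ≠ e₂) (h13 : e₁ ≠ e₃) (h23 : e₂ ≠ e₃)
    (h1 : |e₁| ≤ m) (h2 : |e₂| ≤ m) (h3 : |e₃| ≤ m) (hm : 1 ≤ m)
    (hA : |A'| ≤ H') (hB : |B'| ≤ H')
    (n₁ : N₁ = (A - e₁ * B) ^ 2 - (e₁ - e₂) * (e₁ - e₃) * B ^ 2)
    (n₂ : N₂ = (A - e₂ * B) ^ 2 - (e₂ - e₁) * (e₂ - e₃) * B ^ 2)
    (n₃ : N₃ = (A - e₃ * B) ^ 2 - (e₃ - e₁) * (e₃ - e₂) * B ^ 2)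
    (d₁ : N₁ ^ 2 = D * (A' - e₁ * B')) (d₂ : N₂ ^ 2 = D * (A' - e₂ * B'))
    (d₃ : N₃ ^ 2 = D * (A' - e₃ * B')) :
    A ^ 4 ≤ 648 * m ^ 7 * H' ∧ B ^ 4 ≤ 648 * m ^ 7 * H' := by
  obtain ⟨Δ, hΔ⟩ : ∃ Δ : ℤ, Δ = 2 * (e₂ - e₁) * (e₃ - e₁) * (e₂ - e₃) := ⟨_, rfl⟩
  have hΔ0 : Δ ≠ 0 := by
    rw [hΔ]
    exact mul_ne_zero (mul_ne_zero (mul_ne_zero two_ne_zero (sub_ne_zero.mpr h12.symm))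
      (sub_ne_zero.mpr h13.symm)) (sub_ne_zero.mpr h23)
  have iB : Δ * B ^ 2 = (e₃ - e₂) * N₁ + (-(e₃ - e₁)) * N₂ + (e₂ - e₁) * N₃ := by
    rw [hΔ, n₁, n₂, n₃]; ring
  have iA : Δ * A ^ 2 = ((e₃ - e₂) * (e₁ * e₂ + e₁ * e₃ - e₂ * e₃)) * N₁ +
      (-(e₃ - e₁) * (e₁ * e₂ + e₂ * e₃ - e₁ * e₃)) * N₂ +
      ((e₂ - e₁) * (e₁ * e₃ + e₂ * e₃ - e₁ * e₂)) * N₃ := by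
    rw [hΔ, n₁, n₂, n₃]; ring
  have cross : ∀ M N a b : ℤ, M ^ 2 = D * a → N ^ 2 = D * b → D ∣ M * N := by
    intro M N a b hM hN
    have : D ^ 2 ∣ (M * N) ^ 2 := ⟨a * b, by rw [mul_pow, hM, hN]; ring⟩
    exact (Int.pow_dvd_pow_iff two_ne_zero).mp this
  have hdv : ∀ α β γ : ℤ, D ∣ (α * N₁ + β * N₂ + γ * N₃) ^ 2 := by
    intro α β γ
    have e : (α * N₁ + β * N₂ + γ * N₃) ^ 2 = α ^ 2 * (N₁ * N₁) + β ^ 2 * (N₂ * N₂) +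
      γ ^ 2 * (N₃ * N₃) + 2 * α * β * (N₁ * N₂) + 2 * α * γ * (N₁ * N₃) + 2 * β * γ * (N₂ * N₃) := by
      ring
    rw [e]
    have c11 := (cross _ _ _ _ d₁ d₁).mul_left (α ^ 2)
    have c22 := (cross _ _ _ _ d₂ d₂).mul_left (β ^ 2)
    have c33 := (cross _ _ _ _ d₃ d₃).mul_left (γ ^ 2)
    have c12 := (cross _ _ _ _ d₁ d₂).mul_left (2 * α * β)
    have c13 := (cross _ _ _ _ d₁ d₃).mul_left (2 * α * γ)
    have c23 := (cross _ _ _ _ d₂ d₃).mul_left (2 * β * γ)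
    exact dvd_add (dvd_add (dvd_add (dvd_add (dvd_add c11 c22) c33) c12) c13) c23
  have hDΔ : D ∣ Δ ^ 2 := by
    have hA' : D ∣ (Δ * A ^ 2) ^ 2 := by rw [iA]; exact hdv _ _ _
    have hB' : D ∣ (Δ * B ^ 2) ^ 2 := by rw [iB]; exact hdv _ _ _
    obtain ⟨u, v, huv⟩ := (hc.pow (m := 4) (n := 4))
    have : Δ ^ 2 = u * (Δ * A ^ 2) ^ 2 + v * (Δ * B ^ 2) ^ 2 := by
      linear_combination -Δ ^ 2 * huv
    rw [this]
    exact dvd_add (hA'.mul_left _) (hB'.mul_left _)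
  have hDle : |D| ≤ Δ ^ 2 := Int.le_of_dvd (by positivity) ((abs_dvd _ _).mpr hDΔ)
  have hH' : 0 ≤ H' := (abs_nonneg _).trans hA
  have hN : ∀ N e : ℤ, |e| ≤ m → N ^ 2 = D * (A' - e * B') → N ^ 2 ≤ Δ ^ 2 * (2 * m * H') := by
    intro N e he h
    calc N ^ 2 ≤ |N ^ 2| := le_abs_self _
      _ = |D| * |A' - e * B'| := by rw [h, abs_mul]
      _ ≤ Δ ^ 2 * (2 * m * H') := mul_le_mul hDle (lin_bd hA hB he hm) (abs_nonneg _) (by positivity)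
  have hfin : ∀ α β γ : ℤ, |α| ≤ 6 * m ^ 3 → |β| ≤ 6 * m ^ 3 → |γ| ≤ 6 * m ^ 3 →
      (α * N₁ + β * N₂ + γ * N₃) ^ 2 ≤ Δ ^ 2 * (648 * m ^ 7 * H') := by
    intro α β γ ha hb hg
    have sq : ∀ α : ℤ, |α| ≤ 6 * m ^ 3 → α ^ 2 ≤ 36 * m ^ 6 := by
      intro α ha
      calc α ^ 2 = |α| ^ 2 := (sq_abs _).symm
        _ ≤ (6 * m ^ 3) ^ 2 := by gcongr
        _ = _ := by ring
    have t : ∀ α N : ℤ, α ^ 2 ≤ 36 * m ^ 6 → N ^ 2 ≤ Δ ^ 2 * (2 * m * H') →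
        (α * N) ^ 2 ≤ 36 * m ^ 6 * (Δ ^ 2 * (2 * m * H')) := by
      intro α N h h'
      rw [mul_pow]
      exact mul_le_mul h h' (by positivity) (by positivity)
    have t1 := t α N₁ (sq α ha) (hN _ _ h1 d₁)
    have t2 := t β N₂ (sq β hb) (hN _ _ h2 d₂)
    have t3 := t γ N₃ (sq γ hg) (hN _ _ h3 d₃)
    have hcs : (α * N₁ + β * N₂ + γ * N₃) ^ 2 ≤ 3 * ((α * N₁) ^ 2 + (β * N₂) ^ 2 + (γ * N₃) ^ 2) := by
      nlinarith [sq_nonneg (α * N₁ - β * N₂), sq_nonneg (α * N₁ - γ * N₃),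
        sq_nonneg (β * N₂ - γ * N₃)]
    calc _ ≤ _ := hcs
      _ ≤ 3 * (36 * m ^ 6 * (Δ ^ 2 * (2 * m * H')) + 36 * m ^ 6 * (Δ ^ 2 * (2 * m * H')) +
        36 * m ^ 6 * (Δ ^ 2 * (2 * m * H'))) := by linarith
      _ = _ := by ring
  have hm13 : m ^ 1 ≤ m ^ 3 := mpow_le hm (by norm_num)
  have hΔ2 : 0 < Δ ^ 2 := by positivity
  have e1 : ∀ e e' : ℤ, |e| ≤ m → |e'| ≤ m → |e - e'| ≤ 2 * m := fun e e' h h' =>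
    (diff_bd h h').trans (by linarith)
  have e2 : ∀ e e' : ℤ, |e| ≤ m → |e'| ≤ m → |e - e'| ≤ 6 * m ^ 3 := fun e e' h h' =>
    (e1 _ _ h h').trans (by nlinarith)
  have e3 : ∀ a b c : ℤ, |a| ≤ m → |b| ≤ m → |c| ≤ m →
      ∀ d e f g : ℤ, |d| ≤ m → |e| ≤ m → |f| ≤ m → |g| ≤ m → ∀ x, |x| ≤ 2 * m →
      |x * (a * b + c * d - e * f)| ≤ 6 * m ^ 3 := by
    intro a b c ha hb hc d e f g hd he hf hg x hx
    refine (prod_bd hx (diff_bd (sum_bd (prod_bd ha hb) (prod_bd hc hd)) (prod_bd he hf))).trans ?_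
    apply le_of_eq; ring
  constructor
  · refine le_of_mul_le_mul_left ?_ hΔ2
    have := hfin _ _ _ (e3 e₁ e₂ e₁ h1 h2 h1 e₃ e₂ e₃ e₁ h3 h2 h3 h1 _ (e1 _ _ h3 h2))
      (e3 e₁ e₂ e₂ h1 h2 h2 e₃ e₁ e₃ e₁ h3 h1 h3 h1 (-(e₃ - e₁)) (by rw [abs_neg]; exact e1 _ _ h3 h1))
      (e3 e₁ e₃ e₂ h1 h3 h2 e₃ e₁ e₂ e₁ h3 h1 h2 h1 _ (e1 _ _ h2 h1))
    rw [← iA] at this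
    calc Δ ^ 2 * A ^ 4 = (Δ * A ^ 2) ^ 2 := by ring
      _ ≤ _ := this
  · refine le_of_mul_le_mul_left ?_ hΔ2
    have := hfin (e₃ - e₂) (-(e₃ - e₁)) (e₂ - e₁) (e2 _ _ h3 h2) (by rw [abs_neg]; exact e2 _ _ h3 h1)
      (e2 _ _ h2 h1)
    rw [← iB] at this
    calc Δ ^ 2 * B ^ 4 = (Δ * B ^ 2) ^ 2 := by ring
      _ ≤ _ := this


section HT
open WeierstrassCurve.Affine
variable {e₁ e₂ e₃ : ℤ}

/-- Logarithmic height of a point. -/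
noncomputable def ht (e₁ e₂ e₃ : ℤ) : (crv e₁ e₂ e₃).Point → ℝ
  | .zero => 0
  | .some x _ _ => Real.log (Hq x)

theorem ht_zero : ht e₁ e₂ e₃ 0 = 0 := rfl

theorem ht_some {x y : ℚ} (h : (crv e₁ e₂ e₃).Nonsingular x y) :
    ht e₁ e₂ e₃ (Point.some x y h) = Real.log (Hq x) := rfl

theorem ht_nonneg (P : (crv e₁ e₂ e₃).Point) : 0 ≤ ht e₁ e₂ e₃ P := by
  rcases P with _ | ⟨x, y, h⟩
  · exact le_refl (0 : ℝ)
  · exact Real.log_natCast_nonneg _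

theorem ht_neg (P : (crv e₁ e₂ e₃).Point) : ht e₁ e₂ e₃ (-P) = ht e₁ e₂ e₃ P := by
  rcases P with _ | ⟨x, y, h⟩
  · rfl
  · obtain ⟨h', e⟩ := crv_neg h
    rw [e]; rfl

theorem abs_den (x : ℚ) : |(x.den : ℤ)| ≤ (Hq x : ℤ) := by
  rw [abs_of_nonneg (by positivity)]; exact Hq_den x

theorem Hadd_ne {x₁ y₁ x₂ y₂ x₃ : ℚ} {m : ℤ} (h1 : |e₁| ≤ m) (h2 : |e₂| ≤ m) (h3 : |e₃| ≤ m)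
    (hm : 1 ≤ m)
    (E₁ : y₁ ^ 2 = (x₁ - e₁) * (x₁ - e₂) * (x₁ - e₃))
    (E₂ : y₂ ^ 2 = (x₂ - e₁) * (x₂ - e₂) * (x₂ - e₃)) (hx : x₁ ≠ x₂)
    (hx₃ : x₃ = ((y₁ - y₂) / (x₁ - x₂)) ^ 2 + (e₁ + e₂ + e₃) - x₁ - x₂) :
    (Hq x₃ : ℤ) ≤ 34 * m ^ 4 * (Hq x₁ : ℤ) ^ 2 * (Hq x₂ : ℤ) ^ 2 := by
  obtain ⟨Z₁, hz₁, hZ₁⟩ := pt_int_data E₁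
  obtain ⟨Z₂, hz₂, hZ₂⟩ := pt_int_data E₂
  have b₁ := Z_bd (Hq_num x₁) (abs_den x₁) h1 h2 h3 hm hZ₁
  have b₂ := Z_bd (Hq_num x₂) (abs_den x₂) h1 h2 h3 hm hZ₂
  have hnum := add_num_bd (Hq_num x₁) (abs_den x₁) (Hq_num x₂) (abs_den x₂) h1 h2 h3 hm b₁ b₂
  have A₁ : (x₁.num : ℚ) = x₁ * x₁.den := (Rat.mul_den_eq_num x₁).symm
  have A₂ : (x₂.num : ℚ) = x₂ * x₂.den := (Rat.mul_den_eq_num x₂).symm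
  have B₁ : (x₁.den : ℚ) ≠ 0 := by exact_mod_cast x₁.den_nz
  have B₂ : (x₂.den : ℚ) ≠ 0 := by exact_mod_cast x₂.den_nz
  obtain ⟨l, hl⟩ : ∃ l : ℚ, l = (y₁ - y₂) / (x₁ - x₂) := ⟨_, rfl⟩
  rw [← hl] at hx₃
  have hl' : l * (x₁ - x₂) = y₁ - y₂ := by
    rw [hl]; exact div_mul_cancel₀ _ (sub_ne_zero.mpr hx)
  refine Hq_le _ ((x₁.num * x₂.den - x₂.num * x₁.den) * (x₁.num * x₂.den - x₂.num * x₁.den)) _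
    ?_ ?_ hnum ?_
  · apply mul_self_ne_zero.mpr
    intro h
    have h' : (x₁.num : ℚ) * x₂.den - x₂.num * x₁.den = 0 := by exact_mod_cast h
    rw [A₁, A₂] at h'
    have : (x₁ - x₂) * (x₁.den * x₂.den) = 0 := by linear_combination h'
    exact mul_ne_zero (sub_ne_zero.mpr hx) (mul_ne_zero B₁ B₂) this
  · push_cast
    rw [A₁, A₂, hz₁, hz₂, hx₃]
    linear_combination ((x₁.den : ℚ) ^ 2 * (x₂.den : ℚ) ^ 2) *
      ((l * (x₁ - x₂) + (y₁ - y₂)) * hl' + E₁ + E₂)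
  · have h := diff_bd (prod_bd (Hq_num x₁) (abs_den x₂)) (prod_bd (Hq_num x₂) (abs_den x₁))
    refine (prod_bd h h).trans ?_
    have : 1 ≤ m ^ 4 := one_le_pow₀ hm
    have hh : 0 ≤ (Hq x₁ : ℤ) ^ 2 * (Hq x₂ : ℤ) ^ 2 := by positivity
    nlinarith [mul_le_mul_of_nonneg_right this hh]

theorem dbl_identity {x y X : ℚ} (E : y ^ 2 = (x - e₁) * (x - e₂) * (x - e₃)) (hy : y ≠ 0)
    (hX : X = (((x - e₁) * (x - e₂) + (x - e₁) * (x - e₃) + (x - e₂) * (x - e₃)) / (2 * y)) ^ 2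
       + (e₁ + e₂ + e₃) - 2 * x) :
    4 * (x.den * ((x.num - e₁ * x.den) * (x.num - e₂ * x.den) * (x.num - e₃ * x.den))) ≠ 0 ∧
    X * (4 * (x.den * ((x.num - e₁ * x.den) * (x.num - e₂ * x.den) * (x.num - e₃ * x.den))) : ℤ) =
    (((x.num - e₁ * x.den) * (x.num - e₁ * x.den) - (e₁ - e₂) * (e₁ - e₃) * (x.den * x.den)) *
      ((x.num - e₁ * x.den) * (x.num - e₁ * x.den) - (e₁ - e₂) * (e₁ - e₃) * (x.den * x.den))
      + e₁ * (4 * (x.den * ((x.num - e₁ * x.den) * (x.num - e₂ * x.den) * (x.num - e₃ * x.den)))) :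
      ℤ) := by
  have A₁ : (x.num : ℚ) = x * x.den := (Rat.mul_den_eq_num x).symm
  have B₁ : (x.den : ℚ) ≠ 0 := by exact_mod_cast x.den_nz
  obtain ⟨l, hl⟩ : ∃ l : ℚ, l = ((x - e₁) * (x - e₂) + (x - e₁) * (x - e₃) + (x - e₂) * (x - e₃)) / (2 * y) := ⟨_, rfl⟩
  rw [← hl] at hX
  have hl' : l * (2 * y) = (x - e₁) * (x - e₂) + (x - e₁) * (x - e₃) + (x - e₂) * (x - e₃) := by
    rw [hl]; exact div_mul_cancel₀ _ (mul_ne_zero two_ne_zero hy)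
  constructor
  · intro h
    have h' : (4 : ℚ) * (x.den * ((x.num - e₁ * x.den) * (x.num - e₂ * x.den) *
      (x.num - e₃ * x.den))) = 0 := by exact_mod_cast h
    rw [A₁] at h'
    have : y ^ 2 * (4 * (x.den : ℚ) ^ 4) = 0 := by rw [E]; linear_combination h'
    have : y ^ 2 * (4 * (x.den : ℚ) ^ 4) ≠ 0 := by positivity
    contradiction
  · push_cast
    rw [A₁, hX]
    linear_combination ((x.den : ℚ) ^ 4) *
      ((l * (2 * y) + ((x - e₁) * (x - e₂) + (x - e₁) * (x - e₃) + (x - e₂) * (x - e₃))) * hl'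
       - 4 * l ^ 2 * E)

theorem Hdbl_le {x y X : ℚ} {m : ℤ} (h1 : |e₁| ≤ m) (h2 : |e₂| ≤ m) (h3 : |e₃| ≤ m)
    (hm : 1 ≤ m) (E : y ^ 2 = (x - e₁) * (x - e₂) * (x - e₃)) (hy : y ≠ 0)
    (hX : X = (((x - e₁) * (x - e₂) + (x - e₁) * (x - e₃) + (x - e₂) * (x - e₃)) / (2 * y)) ^ 2
       + (e₁ + e₂ + e₃) - 2 * x) : (Hq X : ℤ) ≤ 96 * m ^ 4 * (Hq x : ℤ) ^ 4 := by
  obtain ⟨h0, hid⟩ := dbl_identity E hy hX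
  obtain ⟨b1, b2⟩ := dbl_bd (Hq_num x) (abs_den x) h1 h2 h3 hm
  exact Hq_le _ _ _ h0 hid b2 b1

theorem Hdbl_ge (h12 : e₁ ≠ e₂) (h13 : e₁ ≠ e₃) (h23 : e₂ ≠ e₃)
    {x y X : ℚ} {m : ℤ} (h1 : |e₁| ≤ m) (h2 : |e₂| ≤ m) (h3 : |e₃| ≤ m)
    (hm : 1 ≤ m) (E : y ^ 2 = (x - e₁) * (x - e₂) * (x - e₃)) (hy : y ≠ 0)
    (hX : X = (((x - e₁) * (x - e₂) + (x - e₁) * (x - e₃) + (x - e₂) * (x - e₃)) / (2 * y)) ^ 2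
       + (e₁ + e₂ + e₃) - 2 * x) : (Hq x : ℤ) ^ 4 ≤ 648 * m ^ 7 * (Hq X : ℤ) := by
  obtain ⟨h0, hid⟩ := dbl_identity E hy hX
  obtain ⟨G, hG⟩ : ∃ G : ℤ, G = 4 * (x.den * ((x.num - e₁ * x.den) * (x.num - e₂ * x.den) *
    (x.num - e₃ * x.den))) := ⟨_, rfl⟩
  obtain ⟨F, hF⟩ : ∃ F : ℤ, F = (((x.num - e₁ * x.den) * (x.num - e₁ * x.den) - (e₁ - e₂) * (e₁ - e₃) * (x.den * x.den)) *
      ((x.num - e₁ * x.den) * (x.num - e₁ * x.den) - (e₁ - e₂) * (e₁ - e₃) * (x.den * x.den))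
      + e₁ * (4 * (x.den * ((x.num - e₁ * x.den) * (x.num - e₂ * x.den) * (x.num - e₃ * x.den)))) :
      ℤ) := ⟨_, rfl⟩
  rw [← hG] at h0
  rw [← hF, ← hG] at hid
  have hG0 : (G : ℚ) ≠ 0 := by exact_mod_cast h0
  have hXd : (X.den : ℚ) ≠ 0 := by exact_mod_cast X.den_nz
  have hXe : X = (F : ℚ) / G := by rw [eq_div_iff hG0]; exact hid
  have hdv : (X.den : ℤ) ∣ G := by rw [hXe]; exact_mod_cast Rat.den_dvd F G
  obtain ⟨D, hD⟩ := hdv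
  have hFD : F = D * X.num := by
    have : (F : ℚ) = D * X.num := by
      rw [← hid, hD, ← Rat.mul_den_eq_num X]; push_cast; ring
    exact_mod_cast this
  have hc : IsCoprime x.num (x.den : ℤ) := by
    rw [Int.isCoprime_iff_gcd_eq_one]; exact x.reduced
  obtain ⟨ra, rb⟩ := dbl_lower hc h12 h13 h23 h1 h2 h3 hm (Hq_num X) (abs_den X) (D := D)
    rfl rfl rfl
    (by
      have : D * (X.num - e₁ * X.den) = F - e₁ * G := by rw [hFD, hD]; ring
      rw [this, hF, hG]; ring)
    (by
      have : D * (X.num - e₂ * X.den) = F - e₂ * G := by rw [hFD, hD]; ring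
      rw [this, hF, hG]; ring)
    (by
      have : D * (X.num - e₃ * X.den) = F - e₃ * G := by rw [hFD, hD]; ring
      rw [this, hF, hG]; ring)
  rcases le_total x.num.natAbs x.den with h | h
  · have : Hq x = x.den := max_eq_right h
    rw [this]; exact rb
  · have : (Hq x : ℤ) = |x.num| := by
      rw [Int.abs_eq_natAbs]; exact_mod_cast max_eq_left h
    rw [this, (show Even 4 by decide).pow_abs]; exact ra

theorem Hq_root (x : ℚ) {m : ℤ} (h1 : |e₁| ≤ m) (hm : 1 ≤ m) (hx : x = e₁) : (Hq x : ℤ) ≤ m := by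
  refine Hq_le e₁ 1 m one_ne_zero (by rw [hx]; simp) h1 (by simpa using hm)

theorem log_bd {H K M : ℤ} {k : ℕ} (hH : 1 ≤ H) (hK : 1 ≤ K) (hM : 1 ≤ M) (h : H ≤ K * M ^ k) :
    Real.log (H : ℝ) ≤ k * Real.log (M : ℝ) + Real.log (K : ℝ) := by
  have a1 : (0 : ℝ) < H := by exact_mod_cast hH
  have a2 : (0 : ℝ) < K := by exact_mod_cast hK
  have a3 : (0 : ℝ) < M := by exact_mod_cast hM
  have h' : (H : ℝ) ≤ K * (M : ℝ) ^ k := by exact_mod_cast h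
  calc Real.log H ≤ Real.log (K * (M : ℝ) ^ k) := Real.log_le_log a1 h'
    _ = _ := by rw [Real.log_mul a2.ne' (by positivity), Real.log_pow]; ring

theorem ht_add {m : ℤ} (h1 : |e₁| ≤ m) (h2 : |e₂| ≤ m) (h3 : |e₃| ≤ m)
    (hm : 1 ≤ m) (P Q : (crv e₁ e₂ e₃).Point) :
    ht e₁ e₂ e₃ (P + Q) ≤ 2 * ht e₁ e₂ e₃ P + 2 * ht e₁ e₂ e₃ Q +
      Real.log ((648 * m ^ 7 : ℤ) : ℝ) := by
  have hK : 1 ≤ 648 * m ^ 7 := by have : 1 ≤ m ^ 7 := one_le_pow₀ hm; linarith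
  have hC : 0 ≤ Real.log ((648 * m ^ 7 : ℤ) : ℝ) := Real.log_nonneg (by exact_mod_cast hK)
  have m47 : m ^ 4 ≤ m ^ 7 := mpow_le hm (by norm_num)
  have hP := ht_nonneg P
  have hQ := ht_nonneg Q
  by_cases hP0 : P = 0
  · subst hP0; rw [zero_add, ht_zero]; linarith
  by_cases hQ0 : Q = 0
  · subst hQ0; rw [add_zero, ht_zero]; linarith
  by_cases hn : P = -Q
  · have : P + Q = 0 := by rw [hn]; exact neg_add_cancel _
    rw [this, ht_zero]; linarith
  rcases P with _ | ⟨x₁, y₁, h₁⟩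
  · exact absurd rfl hP0
  rcases Q with _ | ⟨x₂, y₂, h₂⟩
  · exact absurd rfl hQ0
  have p1 := Hq_pos x₁
  have p2 := Hq_pos x₂
  by_cases hx : x₁ = x₂
  · subst hx
    have hy : y₁ ^ 2 = y₂ ^ 2 := by rw [crv_eq_of_ns h₁, crv_eq_of_ns h₂]
    rcases sq_eq_sq_iff_eq_or_eq_neg.mp hy with h' | h'
    · subst h'
      have hy0 : y₁ ≠ 0 := by
        intro h0
        apply hn
        obtain ⟨h'', e⟩ := crv_neg h₁
        rw [e]
        simp only [h0, neg_zero]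
      obtain ⟨h₃, hadd⟩ := crv_add_self h₁ hy0 _ _ rfl rfl
      rw [hadd, ht_some, ht_some]
      have hb := Hdbl_le h1 h2 h3 hm (crv_eq_of_ns h₁) hy0 rfl
      have := log_bd (K := 648 * m ^ 7) (Hq_pos _) hK p1 (hb.trans (by gcongr; norm_num))
      push_cast at this ⊢
      linarith
    · exfalso
      apply hn
      obtain ⟨h'', e⟩ := crv_neg h₂
      rw [e]
      simp only [h']
  · obtain ⟨y₃, h₃, hadd⟩ := crv_add_ne h₁ h₂ hx
    rw [hadd, ht_some, ht_some, ht_some]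
    have hb := Hadd_ne h1 h2 h3 hm (crv_eq_of_ns h₁) (crv_eq_of_ns h₂) hx rfl
    have := log_bd (K := 648 * m ^ 7) (M := (Hq x₁ : ℤ) * Hq x₂) (k := 2) (Hq_pos _) hK
      (by nlinarith) (hb.trans (by
        calc _ = 34 * m ^ 4 * ((Hq x₁ : ℤ) * Hq x₂) ^ 2 := by ring
          _ ≤ _ := by gcongr; norm_num))
    have q1 : ((Hq x₁ : ℕ) : ℝ) ≠ 0 := by
      have : Hq x₁ ≠ 0 := by omega
      exact_mod_cast this
    have q2 : ((Hq x₂ : ℕ) : ℝ) ≠ 0 := by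
      have : Hq x₂ ≠ 0 := by omega
      exact_mod_cast this
    push_cast at this ⊢
    rw [Real.log_mul q1 q2] at this
    linarith

theorem ht_dbl (h12 : e₁ ≠ e₂) (h13 : e₁ ≠ e₃) (h23 : e₂ ≠ e₃) {m : ℤ} (h1 : |e₁| ≤ m)
    (h2 : |e₂| ≤ m) (h3 : |e₃| ≤ m) (hm : 1 ≤ m) (P : (crv e₁ e₂ e₃).Point) :
    4 * ht e₁ e₂ e₃ P - Real.log ((648 * m ^ 7 : ℤ) : ℝ) ≤ ht e₁ e₂ e₃ (P + P) := by
  have hK : 1 ≤ 648 * m ^ 7 := by have : 1 ≤ m ^ 7 := one_le_pow₀ hm; linarith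
  have hC : 0 ≤ Real.log ((648 * m ^ 7 : ℤ) : ℝ) := Real.log_nonneg (by exact_mod_cast hK)
  have m47 : m ^ 4 ≤ m ^ 7 := mpow_le hm (by norm_num)
  have h2P := ht_nonneg (P + P)
  by_cases hP0 : P = 0
  · subst hP0; rw [zero_add, ht_zero]; linarith
  rcases P with _ | ⟨x₁, y₁, h₁⟩
  · exact absurd rfl hP0
  have p1 := Hq_pos x₁
  have E := crv_eq_of_ns h₁
  by_cases hy0 : y₁ = 0
  · have hb : (Hq x₁ : ℤ) ≤ m := by
      rw [hy0] at E
      have E' : (x₁ - e₁) * (x₁ - e₂) * (x₁ - e₃) = 0 := by rw [← E]; ring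
      rcases mul_eq_zero.mp E' with h | h
      · rcases mul_eq_zero.mp h with h | h
        · exact Hq_root x₁ h1 hm (sub_eq_zero.mp h)
        · exact Hq_root x₁ h2 hm (sub_eq_zero.mp h)
      · exact Hq_root x₁ h3 hm (sub_eq_zero.mp h)
    have := log_bd (K := 648 * m ^ 7) (M := 1) (k := 0) (H := (Hq x₁ : ℤ) ^ 4) (one_le_pow₀ p1) hK
      le_rfl (by
        calc (Hq x₁ : ℤ) ^ 4 ≤ m ^ 4 := by gcongr
          _ ≤ _ := by linarith [hK, m47, one_le_pow₀ hm (n := 7)])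
    rw [ht_some]
    push_cast at this h2P ⊢
    rw [Real.log_pow] at this
    push_cast at this
    linarith
  · obtain ⟨h₃, hadd⟩ := crv_add_self h₁ hy0 _ _ rfl rfl
    rw [hadd, ht_some, ht_some]
    have hb := Hdbl_ge h12 h13 h23 h1 h2 h3 hm E hy0 rfl
    have := log_bd (K := 648 * m ^ 7) (k := 1) (H := (Hq x₁ : ℤ) ^ 4) (one_le_pow₀ p1) hK
      (Hq_pos _) (hb.trans (by rw [pow_one]))
    push_cast at this ⊢
    rw [Real.log_pow] at this
    push_cast at this
    linarith

theorem ht_finite (R : ℝ) : {P : (crv e₁ e₂ e₃).Point | ht e₁ e₂ e₃ P ≤ R}.Finite := by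
  obtain ⟨M, hM⟩ := exists_nat_gt (Real.exp R)
  let f : (crv e₁ e₂ e₃).Point → Option (ℤ × ℕ × Bool)
    | .zero => none
    | .some x y _ => some (x.num, x.den, decide (0 ≤ y))
  have hfin : (insert none (some '' ((Set.Icc (-(M : ℤ)) M) ×ˢ ((Set.Iic M) ×ˢ
      (Set.univ : Set Bool))))).Finite := by
    apply Set.Finite.insert
    apply Set.Finite.image
    exact (Set.finite_Icc _ _).prod ((Set.finite_Iic _).prod Set.finite_univ)
  refine Set.Finite.of_injOn (f := f) ?_ ?_ hfin
  · intro P hP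
    rcases P with _ | ⟨x, y, h⟩
    · exact Set.mem_insert _ _
    · apply Set.mem_insert_of_mem
      refine ⟨(x.num, x.den, decide (0 ≤ y)), ?_, rfl⟩
      have hP' : Real.log (Hq x) ≤ R := hP
      have hpos : (0 : ℝ) < Hq x := by
        have := Hq_pos x
        have : 0 < Hq x := by omega
        exact_mod_cast this
      have hle : (Hq x : ℝ) < M := by
        rw [Real.log_le_iff_le_exp hpos] at hP'
        linarith
      have hle' : Hq x < M := by exact_mod_cast hle
      have a1 := Hq_num x
      have a2 := Hq_den x
      rw [abs_le] at a1
      simp only [Set.mem_prod, Set.mem_Icc, Set.mem_Iic, Set.mem_univ, and_true]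
      omega
  · intro P _ Q _ hPQ
    rcases P with _ | ⟨x₁, y₁, h₁⟩ <;> rcases Q with _ | ⟨x₂, y₂, h₂⟩
    · rfl
    · exact absurd hPQ (by simp [f])
    · exact absurd hPQ (by simp [f])
    · simp only [f, Option.some.injEq, Prod.mk.injEq, decide_eq_decide] at hPQ
      obtain ⟨hn, hd, hs⟩ := hPQ
      have hx : x₁ = x₂ := Rat.ext hn hd
      subst hx
      have hy : y₁ ^ 2 = y₂ ^ 2 := by rw [crv_eq_of_ns h₁, crv_eq_of_ns h₂]
      have : y₁ = y₂ := by
        rcases sq_eq_sq_iff_eq_or_eq_neg.mp hy with h' | h'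
        · exact h'
        · rcases le_total 0 y₁ with h | h
          · have := hs.mp h; linarith
          · by_cases h0 : 0 ≤ y₂
            · have := hs.mpr h0; linarith
            · linarith
      subst this
      rfl
end HT


theorem coprime_dvd_step {g v M k : ℤ} (hg : g ^ 2 ∣ v * M ^ 2) {α β : ℤ} (h : α * g + β * M = 2) :
    g ^ 2 ∣ 8 * v := by
  obtain ⟨t, ht⟩ := hg
  refine ⟨v * α ^ 3 * g + 3 * v * α ^ 2 * β * M + 3 * α * β ^ 2 * g * t + β ^ 3 * M * t, ?_⟩
  have : (8 : ℤ) = (α * g + β * M) ^ 3 := by rw [h]; norm_num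
  rw [this]
  linear_combination (3 * α * g * β ^ 2 + β ^ 3 * M) * ht

theorem sep_den {a d q₁ q₂ W₁ W₂ Y₁ Y₂ c s g : ℤ} (hg1 : 1 ≤ g) (hgd : g ∣ d) (hgY : g ∣ Y₁ - Y₂)
    (hW₁ : d ∣ W₁ - a) (hW₂ : d ∣ W₂ - a) (hY₁ : d ∣ Y₁ ^ 2 - a ^ 4) (hc : IsCoprime a d)
    (w₁ : W₁ ≠ 0) (w₂ : W₂ ≠ 0) (hd0 : d ≠ 0) (hc0 : c ≠ 0) (hne : q₁ * W₂ - q₂ * W₁ ≠ 0)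
    (x₃ : ℚ) (hx₃ : x₃ = ((((c * Y₁ / W₁ ^ 2 : ℚ)) - (-(c * Y₂ / W₂ ^ 2 : ℚ))) /
      ((c * q₁ * d / W₁ : ℚ) - (c * q₂ * d / W₂ : ℚ))) ^ 2 + s - (c * q₁ * d / W₁ : ℚ)
        - (c * q₂ * d / W₂ : ℚ)) :
    g ^ 2 ≤ 8 * (x₃.den : ℤ) := by
  have w₁' : (W₁ : ℚ) ≠ 0 := by exact_mod_cast w₁
  have w₂' : (W₂ : ℚ) ≠ 0 := by exact_mod_cast w₂
  have d' : (d : ℚ) ≠ 0 := by exact_mod_cast hd0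
  have c' : (c : ℚ) ≠ 0 := by exact_mod_cast hc0
  have ne' : ((q₁ : ℚ) * W₂ - q₂ * W₁) ≠ 0 := by exact_mod_cast hne
  obtain ⟨M, hM⟩ : ∃ M : ℤ, M = Y₁ * W₂ ^ 2 + Y₂ * W₁ ^ 2 := ⟨_, rfl⟩
  have hx : x₃ * (W₁ * W₂ * d * (q₁ * W₂ - q₂ * W₁)) ^ 2 = M ^ 2 +
      d ^ 2 * (s * (W₁ * W₂ * (q₁ * W₂ - q₂ * W₁)) ^ 2
       - c * d * (q₁ * W₂ + q₂ * W₁) * (W₁ * W₂) * (q₁ * W₂ - q₂ * W₁) ^ 2) := by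
    have hl : (((c * Y₁ / W₁ ^ 2 : ℚ)) - (-(c * Y₂ / W₂ ^ 2 : ℚ))) /
      ((c * q₁ * d / W₁ : ℚ) - (c * q₂ * d / W₂ : ℚ)) = M / (W₁ * W₂ * d * (q₁ * W₂ - q₂ * W₁)) := by
      have e1 : (((c * Y₁ / W₁ ^ 2 : ℚ)) - (-(c * Y₂ / W₂ ^ 2 : ℚ))) =
        c * M / (W₁ * W₂) ^ 2 := by rw [hM]; push_cast; field_simp; ring
      have e2 : ((c * q₁ * d / W₁ : ℚ) - (c * q₂ * d / W₂ : ℚ)) =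
        c * d * (q₁ * W₂ - q₂ * W₁) / (W₁ * W₂) := by field_simp
      rw [e1, e2, div_div_div_eq, div_eq_div_iff (by positivity) (by positivity)]
      ring
    have hne2 : ((W₁ : ℚ) * W₂ * d * (q₁ * W₂ - q₂ * W₁)) ≠ 0 := by positivity
    have e3 : (c * q₁ * d / W₁ : ℚ) * W₁ = c * q₁ * d := div_mul_cancel₀ _ w₁'
    have e4 : (c * q₂ * d / W₂ : ℚ) * W₂ = c * q₂ * d := div_mul_cancel₀ _ w₂'
    have e5 : (M / (W₁ * W₂ * d * (q₁ * W₂ - q₂ * W₁)) : ℚ) *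
      (W₁ * W₂ * d * (q₁ * W₂ - q₂ * W₁)) = M := div_mul_cancel₀ _ hne2
    rw [hl] at hx₃
    generalize (M / (W₁ * W₂ * d * (q₁ * W₂ - q₂ * W₁)) : ℚ) = l at *
    generalize (c * q₁ * d / W₁ : ℚ) = u at *
    generalize (c * q₂ * d / W₂ : ℚ) = v at *
    rw [hx₃]
    have e6 : (l * (W₁ * W₂ * d * (q₁ * W₂ - q₂ * W₁))) ^ 2 = (M : ℚ) ^ 2 := by rw [e5]
    linear_combination e6 - W₂ * (W₁ * W₂ * d ^ 2 * (q₁ * W₂ - q₂ * W₁) ^ 2) * e3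
      - W₁ * (W₁ * W₂ * d ^ 2 * (q₁ * W₂ - q₂ * W₁) ^ 2) * e4
  obtain ⟨k, hk⟩ : ∃ k : ℤ, k = (s * (W₁ * W₂ * (q₁ * W₂ - q₂ * W₁)) ^ 2
       - c * d * (q₁ * W₂ + q₂ * W₁) * (W₁ * W₂) * (q₁ * W₂ - q₂ * W₁) ^ 2) := ⟨_, rfl⟩
  have hint : x₃.num * (W₁ * W₂ * d * (q₁ * W₂ - q₂ * W₁)) ^ 2 = x₃.den * (M ^ 2 + d ^ 2 * k) := by
    have : (x₃.num : ℚ) * (W₁ * W₂ * d * (q₁ * W₂ - q₂ * W₁)) ^ 2 =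
        x₃.den * (M ^ 2 + d ^ 2 * k) := by
      rw [← Rat.mul_den_eq_num x₃, hk]; push_cast; linear_combination x₃.den * hx
    exact_mod_cast this
  obtain ⟨d₀, rfl⟩ := hgd
  have hgv : g ^ 2 ∣ (x₃.den : ℤ) * M ^ 2 := by
    refine ⟨x₃.num * (W₁ * W₂ * d₀ * (q₁ * W₂ - q₂ * W₁)) ^ 2 - x₃.den * d₀ ^ 2 * k, ?_⟩
    linear_combination -hint
  obtain ⟨i₁, hi₁⟩ := hW₁
  obtain ⟨i₂, hi₂⟩ := hW₂
  obtain ⟨j, hj⟩ := hgY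
  obtain ⟨i₃, hi₃⟩ := hY₁
  have hcg : IsCoprime (Y₁ * a ^ 2) g := by
    have ha : IsCoprime a g := IsCoprime.of_mul_right_left hc
    have h4 : IsCoprime (a ^ 4) g := ha.pow_left
    have : IsCoprime (Y₁ ^ 2) g := by
      have e : Y₁ ^ 2 = a ^ 4 + g * (d₀ * i₃) := by linear_combination hi₃
      rw [e]
      exact h4.add_mul_left_left _
    exact IsCoprime.mul_left ((IsCoprime.pow_left_iff (by norm_num)).mp this) ha.pow_left
  obtain ⟨r, t, hrt⟩ := hcg
  have eW₁ : W₁ = a + g * (d₀ * i₁) := by linear_combination hi₁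
  have eW₂ : W₂ = a + g * (d₀ * i₂) := by linear_combination hi₂
  have eY : Y₂ = Y₁ - g * j := by linear_combination -hj
  obtain ⟨z, hz⟩ : ∃ z : ℤ, M = 2 * (Y₁ * a ^ 2) + g * z := by
    rw [hM, eW₁, eW₂, eY]
    refine ⟨Y₁ * (2 * a * (d₀ * i₂) + g * (d₀ * i₂) ^ 2) + Y₁ * (2 * a * (d₀ * i₁) +
      g * (d₀ * i₁) ^ 2) - j * (a + g * (d₀ * i₁)) ^ 2, ?_⟩
    ring
  have hdv := coprime_dvd_step (k := 0) hgv (α := 2 * t - r * z) (β := r)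
    (by rw [hz]; linear_combination 2 * hrt)
  have hpos : (0 : ℤ) < 8 * x₃.den := by
    have : (0 : ℤ) < x₃.den := by exact_mod_cast x₃.den_pos
    linarith
  exact Int.le_of_dvd hpos hdv


section PTS
open WeierstrassCurve.Affine

theorem ht_sub_ge {e₁ e₂ e₃ : ℤ} {x₁ y₁ x₂ y₂ : ℚ} (h₁ : (crv e₁ e₂ e₃).Nonsingular x₁ y₁)
    (h₂ : (crv e₁ e₂ e₃).Nonsingular x₂ y₂) (hx : x₁ ≠ x₂) (g : ℤ) (hg : 1 ≤ g)
    (h : ∀ x₃ : ℚ, x₃ = ((y₁ - -y₂) / (x₁ - x₂)) ^ 2 + ((e₁ + e₂ + e₃ : ℤ) : ℚ) - x₁ - x₂ →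
      g ^ 2 ≤ 8 * (x₃.den : ℤ)) :
    2 * Real.log g - Real.log 8 ≤ ht e₁ e₂ e₃ (Point.some x₁ y₁ h₁ - Point.some x₂ y₂ h₂) := by
  obtain ⟨h₂', hneg⟩ := crv_neg h₂
  obtain ⟨y₃, h₃, hadd⟩ := crv_add_ne h₁ h₂' hx
  have hs : Point.some x₁ y₁ h₁ - Point.some x₂ y₂ h₂ = _ :=
    (sub_eq_add_neg _ _).trans (by rw [hneg, hadd])
  rw [hs, ht_some]
  have hb := h _ rfl
  have hle := Hq_den (((y₁ - -y₂) / (x₁ - x₂)) ^ 2 + ((e₁ + e₂ + e₃ : ℤ) : ℚ) - x₁ - x₂)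
  have := log_bd (H := g ^ 2) (K := 8) (k := 1) (one_le_pow₀ hg) (by norm_num) (Hq_pos _)
    (hb.trans (by rw [pow_one]; linarith))
  push_cast at this ⊢
  rw [Real.log_pow] at this
  push_cast at this
  linarith

theorem crv_pt_eq {c₁ c₂ c₃ q d W Y : ℚ} (hW : W ≠ 0)
    (hY : Y ^ 2 = W * ((W + c₁ * q * d) * (W + c₂ * q * d) * (W + c₃ * q * d))) :
    (c₁ * c₂ * c₃ * Y / W ^ 2) ^ 2 = (c₁ * c₂ * c₃ * q * d / W - -(c₂ * c₃)) *
      (c₁ * c₂ * c₃ * q * d / W - -(c₁ * c₃)) * (c₁ * c₂ * c₃ * q * d / W - -(c₁ * c₂)) := by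
  have e1 : c₁ * c₂ * c₃ * q * d / W - -(c₂ * c₃) = c₂ * c₃ * (W + c₁ * q * d) / W := by
    field_simp; ring
  have e2 : c₁ * c₂ * c₃ * q * d / W - -(c₁ * c₃) = c₁ * c₃ * (W + c₂ * q * d) / W := by
    field_simp; ring
  have e3 : c₁ * c₂ * c₃ * q * d / W - -(c₁ * c₂) = c₁ * c₂ * (W + c₃ * q * d) / W := by
    field_simp; ring
  rw [e1, e2, e3, div_pow, mul_pow, hY]
  field_simp

open scoped Classical in
theorem pts_bound (N Q : ℕ) (hN : 2 ≤ N) (hQ : Q ≤ N) (μ d : ℤ) (hd : (N : ℤ) ^ 400 ≤ d)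
    (hc : IsCoprime (μ ^ 2) d) (h3 : 3 ≤ (goodIdx N (μ ^ 2) d).card) (c₁ c₂ c₃ : ℕ)
    (p₁ : 0 < c₁ ∧ c₁ < N) (p₂ : 0 < c₂ ∧ c₂ < N) (p₃ : 0 < c₃ ∧ c₃ < N)
    (h12 : c₁ ≠ c₂) (h13 : c₁ ≠ c₃) (h23 : c₂ ≠ c₃) :
    ((goodIdx N (μ ^ 2) d ×ˢ Finset.Icc 1 Q).filter (fun p => p.1 + c₁ * p.2 ∈ goodIdx N (μ ^ 2) d ∧
      p.1 + c₂ * p.2 ∈ goodIdx N (μ ^ 2) d ∧ p.1 + c₃ * p.2 ∈ goodIdx N (μ ^ 2) d)).card ≤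
    2 * (4 + (2 * 2 ^ (badP (-(c₂ * c₃ : ℤ)) (-(c₁ * c₃ : ℤ)) (-(c₁ * c₂ : ℤ))).card) ^ 2) ^ 16 := by
  set e₁ : ℤ := -(c₂ * c₃ : ℤ) with he₁
  set e₂ : ℤ := -(c₁ * c₃ : ℤ) with he₂
  set e₃ : ℤ := -(c₁ * c₂ : ℤ) with he₃
  set T := (goodIdx N (μ ^ 2) d ×ˢ Finset.Icc 1 Q).filter (fun p => p.1 + c₁ * p.2 ∈ goodIdx N (μ ^ 2) d ∧
      p.1 + c₂ * p.2 ∈ goodIdx N (μ ^ 2) d ∧ p.1 + c₃ * p.2 ∈ goodIdx N (μ ^ 2) d) with hT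
  have hN' : (2 : ℤ) ≤ N := by exact_mod_cast hN
  have hNd : (N : ℤ) < d := by
    calc (N : ℤ) = (N : ℤ) ^ 1 := (pow_one _).symm
      _ < (N : ℤ) ^ 400 := pow_lt_pow_right₀ (by linarith) (by norm_num)
      _ ≤ d := hd
  have hd1 : 1 ≤ d := by linarith
  have hμ : μ ^ 2 ≠ 0 := by
    intro h0
    rw [h0, isCoprime_zero_left] at hc
    rcases Int.isUnit_iff.mp hc with h | h <;> omega
  have hμ1 : 1 ≤ μ ^ 2 := by have := sq_nonneg μ; omega
  -- distinctness of roots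
  have f12 : e₁ ≠ e₂ := by
    rw [he₁, he₂]; intro h
    have : (c₃ : ℤ) * c₂ = c₃ * c₁ := by linear_combination -h
    have := mul_left_cancel₀ (by have := p₃.1; exact_mod_cast this.ne') this
    exact h12 (by exact_mod_cast this.symm)
  have f13 : e₁ ≠ e₃ := by
    rw [he₁, he₃]; intro h
    have : (c₂ : ℤ) * c₃ = c₂ * c₁ := by linear_combination -h
    have := mul_left_cancel₀ (by have := p₂.1; exact_mod_cast this.ne') this
    exact h13 (by exact_mod_cast this.symm)
  have f23 : e₂ ≠ e₃ := by
    rw [he₂, he₃]; intro h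
    have : (c₁ : ℤ) * c₃ = c₁ * c₂ := by linear_combination -h
    have := mul_left_cancel₀ (by have := p₁.1; exact_mod_cast this.ne') this
    exact h23 (by exact_mod_cast this.symm)
  have hm1 : (1 : ℤ) ≤ (N : ℤ) ^ 2 := one_le_pow₀ (by linarith)
  have hbd : ∀ u v : ℕ, u < N → v < N → |(-(u * v : ℤ))| ≤ (N : ℤ) ^ 2 := by
    intro u v hu hv
    rw [abs_neg, abs_of_nonneg (by positivity), sq]
    have hu' : (u : ℤ) ≤ N := by exact_mod_cast hu.le
    have hv' : (v : ℤ) ≤ N := by exact_mod_cast hv.le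
    gcongr
  have b1 : |e₁| ≤ (N : ℤ) ^ 2 := hbd _ _ p₂.2 p₃.2
  have b2 : |e₂| ≤ (N : ℤ) ^ 2 := hbd _ _ p₁.2 p₃.2
  have b3 : |e₃| ≤ (N : ℤ) ^ 2 := hbd _ _ p₁.2 p₂.2
  -- the data
  obtain ⟨W, hW⟩ : ∃ W : ℕ × ℕ → ℤ, ∀ p, W p = μ ^ 2 + (p.1 : ℤ) * d := ⟨_, fun _ => rfl⟩
  have hdat : ∀ p ∈ T, ∃ Y : ℤ, Y ^ 2 = W p * ((W p + c₁ * p.2 * d) * (W p + c₂ * p.2 * d) *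
      (W p + c₃ * p.2 * d)) := by
    intro p hp
    simp only [hT, Finset.mem_filter, Finset.mem_product, mem_goodIdx] at hp
    obtain ⟨⟨⟨-, X₀, h0⟩, -⟩, ⟨-, X₁, h1⟩, ⟨-, X₂, h2⟩, ⟨-, X₃, h3⟩⟩ := hp
    refine ⟨X₀ * X₁ * X₂ * X₃, ?_⟩
    push_cast at h1 h2 h3
    rw [show (X₀ * X₁ * X₂ * X₃) ^ 2 = X₀ ^ 2 * (X₁ ^ 2 * X₂ ^ 2 * X₃ ^ 2) by ring, ← h0, ← h1,
      ← h2, ← h3, hW]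
    ring
  have hqT : ∀ p ∈ T, p.1 < N ∧ 1 ≤ p.2 ∧ p.2 ≤ Q := by
    intro p hp
    simp only [hT, Finset.mem_filter, Finset.mem_product, mem_goodIdx, Finset.mem_Icc] at hp
    exact ⟨hp.1.1.1, hp.1.2.1, hp.1.2.2⟩
  have hWpos : ∀ p, 1 ≤ W p := by
    intro p
    rw [hW]
    have : 0 ≤ (p.1 : ℤ) * d := by positivity
    linarith
  have hWa : ∀ p, d ∣ W p - μ ^ 2 := fun p => ⟨p.1, by rw [hW]; ring⟩
  choose! Y hY using hdat
  have hYa : ∀ p ∈ T, d ∣ Y p ^ 2 - (μ ^ 2) ^ 4 := by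
    intro p hp
    rw [hY p hp]
    obtain ⟨k, hk⟩ := hWa p
    have : W p = μ ^ 2 + d * k := by linear_combination hk
    rw [← Int.modEq_iff_dvd]
    symm
    have m0 : W p ≡ μ ^ 2 [ZMOD d] := ((Int.modEq_iff_dvd.mpr (hWa p))).symm
    have m1 : ∀ c : ℤ, W p + c * p.2 * d ≡ μ ^ 2 [ZMOD d] := by
      intro c
      have : W p + c * p.2 * d ≡ W p [ZMOD d] := by
        rw [Int.modEq_iff_dvd]; exact ⟨-(c * p.2), by ring⟩
      exact this.trans m0
    have := m0.mul (((m1 c₁).mul (m1 c₂)).mul (m1 c₃))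
    refine this.trans (by rw [show μ ^ 2 * (μ ^ 2 * μ ^ 2 * μ ^ 2) = (μ ^ 2) ^ 4 by ring])
  obtain ⟨c, hcdef⟩ : ∃ c : ℤ, c = c₁ * c₂ * c₃ := ⟨_, rfl⟩
  have hc1 : 1 ≤ c := by
    rw [hcdef]
    have := Nat.mul_pos (Nat.mul_pos p₁.1 p₂.1) p₃.1
    exact_mod_cast this
  have hcN : c ≤ (N : ℤ) ^ 3 := by
    have h : c₁ * c₂ * c₃ ≤ N * N * N := Nat.mul_le_mul (Nat.mul_le_mul p₁.2.le p₂.2.le) p₃.2.le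
    rw [hcdef]
    calc ((c₁ : ℤ) * c₂ * c₃) ≤ N * N * N := by exact_mod_cast h
      _ = _ := by ring
  have hns : ∀ p ∈ T, (crv e₁ e₂ e₃).Nonsingular ((c : ℚ) * ((p.2 : ℤ) : ℚ) * d / W p)
      ((c : ℚ) * Y p / (W p : ℚ) ^ 2) := by
    intro p hp
    apply crv_ns f12 f13 f23
    have hw : (W p : ℚ) ≠ 0 := by have := hWpos p; exact_mod_cast (by omega : W p ≠ 0)
    have hy : ((Y p : ℤ) : ℚ) ^ 2 = W p * ((W p + c₁ * p.2 * d) * (W p + c₂ * p.2 * d) *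
      (W p + c₃ * p.2 * d)) := by exact_mod_cast hY p hp
    have := crv_pt_eq hw hy
    rw [hcdef, he₁, he₂, he₃]
    push_cast
    exact this
  obtain ⟨Pt, hPt⟩ : ∃ Pt : ℕ × ℕ → (crv e₁ e₂ e₃).Point, ∀ p (hp : p ∈ T),
      Pt p = Point.some _ _ (hns p hp) :=
    ⟨fun p => if hp : p ∈ T then Point.some _ _ (hns p hp) else 0, fun p hp => dif_pos hp⟩
  have hxne : ∀ p ∈ T, ∀ p' ∈ T, p ≠ p' → (p.2 : ℤ) * W p' - (p'.2 : ℤ) * W p ≠ 0 := by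
    intro p hp p' hp' hne h0
    obtain ⟨-, q1, q2⟩ := hqT p hp
    obtain ⟨-, q1', q2'⟩ := hqT p' hp'
    have hdv : d ∣ (p.2 : ℤ) - p'.2 := by
      have : d ∣ μ ^ 2 * ((p.2 : ℤ) - p'.2) := by
        refine ⟨p'.2 * p.1 - p.2 * p'.1, ?_⟩
        rw [hW, hW] at h0
        linear_combination h0
      exact hc.symm.dvd_of_dvd_mul_left this
    have heq : (p.2 : ℤ) - p'.2 = 0 := by
      apply Int.eq_zero_of_abs_lt_dvd hdv
      rw [abs_lt]; omega
    have heq2 : p.2 = p'.2 := by omega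
    have : (p.2 : ℤ) * W p' = p.2 * W p := by rw [← heq2] at h0; linarith
    have := mul_left_cancel₀ (by omega) this
    rw [hW, hW] at this
    have : (p'.1 : ℤ) * d = p.1 * d := by linarith
    have := mul_right_cancel₀ (by omega) this
    exact hne (Prod.ext (by exact_mod_cast this.symm) heq2)
  have hxne' : ∀ p ∈ T, ∀ p' ∈ T, p ≠ p' → (c : ℚ) * ((p.2 : ℤ) : ℚ) * d / W p ≠
      (c : ℚ) * ((p'.2 : ℤ) : ℚ) * d / W p' := by
    intro p hp p' hp' hne h
    have w1 := hWpos p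
    have w2 := hWpos p'
    rw [div_eq_div_iff (by exact_mod_cast (by omega : W p ≠ 0))
      (by exact_mod_cast (by omega : W p' ≠ 0))] at h
    have h' : c * (p.2 : ℤ) * d * W p' = c * (p'.2 : ℤ) * d * W p := by exact_mod_cast h
    have : c * d * ((p.2 : ℤ) * W p' - (p'.2 : ℤ) * W p) = 0 := by linear_combination h'
    exact mul_ne_zero (mul_ne_zero (by omega) (by omega)) (hxne p hp p' hp' hne) this
  have hinj : Set.InjOn Pt T := by
    intro p hp p' hp' h
    by_contra hne
    rw [hPt p hp, hPt p' hp', Point.some.injEq] at h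
    exact hxne' p hp p' hp' hne h.1
  have hgpos : ∀ z : ℤ, (1 : ℤ) ≤ Int.gcd d z := by
    intro z
    have : 0 < Int.gcd d z := Int.gcd_pos_of_ne_zero_left _ (by omega)
    exact_mod_cast this
  have hpair : ∀ p ∈ T, ∀ p' ∈ T, p ≠ p' →
      2 * Real.log ((Int.gcd d (Y p - Y p') : ℤ) : ℝ) - Real.log 8 ≤ ht e₁ e₂ e₃ (Pt p - Pt p') := by
    intro p hp p' hp' hne
    rw [hPt p hp, hPt p' hp']
    apply ht_sub_ge _ _ (hxne' p hp p' hp' hne) _ (hgpos _)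
    intro x₃ hx₃
    have w1 := hWpos p
    have w2 := hWpos p'
    exact sep_den (hgpos _) (Int.gcd_dvd_left _ _) (Int.gcd_dvd_right _ _) (hWa p) (hWa p') (hYa p hp)
      hc (by omega) (by omega) (by omega) (by omega) (hxne p hp p' hp' hne) x₃ hx₃
  -- logs
  have lN : Real.log 2 ≤ Real.log N := Real.log_le_log (by norm_num) (by exact_mod_cast hN)
  have l2 : 0 < Real.log 2 := Real.log_pos (by norm_num)
  have l8 : Real.log 8 = 3 * Real.log 2 := by
    rw [show (8 : ℝ) = 2 ^ 3 by norm_num, Real.log_pow]; norm_num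
  have hdR : (0 : ℝ) < d := by exact_mod_cast hd1
  have hNR : (0 : ℝ) < N := by exact_mod_cast (by omega : 0 < N)
  have ld : 400 * Real.log N ≤ Real.log d := by
    have : Real.log ((N : ℝ) ^ 400) ≤ Real.log d :=
      Real.log_le_log (by positivity) (by exact_mod_cast hd)
    rw [Real.log_pow] at this
    exact_mod_cast this
  have lC : Real.log ((648 * ((N : ℤ) ^ 2) ^ 7 : ℤ) : ℝ) ≤ 24 * Real.log N := by
    have : Real.log ((648 * ((N : ℤ) ^ 2) ^ 7 : ℤ) : ℝ) ≤ Real.log ((N : ℝ) ^ 24) := by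
      apply Real.log_le_log
      · push_cast; positivity
      · push_cast
        calc (648 : ℝ) * ((N : ℝ) ^ 2) ^ 7 ≤ 2 ^ 10 * (N : ℝ) ^ 14 := by
              rw [← pow_mul]; gcongr; norm_num
          _ ≤ (N : ℝ) ^ 10 * (N : ℝ) ^ 14 := by gcongr; exact_mod_cast hN
          _ = _ := by ring
    rw [Real.log_pow] at this
    exact_mod_cast this
  have lC0 : 0 ≤ Real.log ((648 * ((N : ℤ) ^ 2) ^ 7 : ℤ) : ℝ) := by
    apply Real.log_nonneg
    have : (1 : ℤ) ≤ ((N : ℤ) ^ 2) ^ 7 := one_le_pow₀ hm1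
    exact_mod_cast (by linarith : (1 : ℤ) ≤ 648 * ((N : ℤ) ^ 2) ^ 7)
  -- the height bound
  have ha : (μ ^ 2) ^ 3 ≤ (N : ℤ) ^ 6 * d ^ 4 := by
    obtain ⟨x, hx, y, hy, z, hz, hxy, hxz, hyz⟩ := Finset.two_lt_card.mp (by omega : 2 < (goodIdx N (μ ^ 2) d).card)
    exact large_a N (μ ^ 2) d hμ1 hd1 x y z hx hy hz hxy hxz hyz
  have hhb : ∀ p ∈ T, ht e₁ e₂ e₃ (Pt p) ≤ 5 * Real.log N + 4 / 3 * Real.log d := by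
    intro p hp
    obtain ⟨n1, q1, q2⟩ := hqT p hp
    rw [hPt p hp, ht_some]
    have w1 := hWpos p
    have hq : (p.2 : ℤ) ≤ N := by exact_mod_cast q2.trans hQ
    have hn : (p.1 : ℤ) ≤ N := by exact_mod_cast n1.le
    have hH : (Hq ((c : ℚ) * ((p.2 : ℤ) : ℚ) * d / W p) : ℤ) ≤ max (c * p.2 * d) (W p) := by
      apply Hq_le (c * p.2 * d) (W p) _ (by omega)
      · have hw : (W p : ℚ) ≠ 0 := by exact_mod_cast (by omega : W p ≠ 0)
        rw [div_mul_cancel₀ _ hw]; push_cast; ring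
      · rw [abs_of_nonneg (by positivity)]; exact le_max_left _ _
      · rw [abs_of_nonneg (by omega)]; exact le_max_right _ _
    have hH3 : (Hq ((c : ℚ) * ((p.2 : ℤ) : ℚ) * d / W p) : ℤ) ^ 3 ≤ (N : ℤ) ^ 15 * d ^ 4 := by
      have h0 : (0 : ℤ) ≤ Hq ((c : ℚ) * ((p.2 : ℤ) : ℚ) * d / W p) := by positivity
      rcases le_max_iff.mp hH with h | h
      · calc _ ≤ (c * p.2 * d) ^ 3 := by gcongr
          _ ≤ ((N : ℤ) ^ 3 * N * d) ^ 3 := by gcongr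
          _ = (N : ℤ) ^ 12 * d ^ 3 := by ring
          _ ≤ (N : ℤ) ^ 15 * d ^ 4 := by
            gcongr <;> first | linarith | norm_num
      · have hle : W p ≤ μ ^ 2 + N * d := by rw [hW]; gcongr
        have hcv : (μ ^ 2 + N * d) ^ 3 ≤ 4 * ((μ ^ 2) ^ 3 + (N * d) ^ 3) := by
          have x0 : 0 ≤ μ ^ 2 := by positivity
          have y0 : 0 ≤ (N : ℤ) * d := by positivity
          generalize μ ^ 2 = x at *
          generalize (N : ℤ) * d = y at *
          nlinarith [mul_nonneg (add_nonneg x0 y0) (sq_nonneg (x - y))]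
        calc _ ≤ (W p) ^ 3 := by gcongr
          _ ≤ (μ ^ 2 + N * d) ^ 3 := by gcongr
          _ ≤ _ := hcv
          _ ≤ 4 * ((N : ℤ) ^ 6 * d ^ 4 + (N : ℤ) ^ 6 * d ^ 4) := by
            have : ((N : ℤ) * d) ^ 3 ≤ (N : ℤ) ^ 6 * d ^ 4 := by
              rw [mul_pow]
              gcongr <;> first | linarith | norm_num
            linarith
          _ = 2 ^ 3 * ((N : ℤ) ^ 6 * d ^ 4) := by ring
          _ ≤ (N : ℤ) ^ 9 * ((N : ℤ) ^ 6 * d ^ 4) := by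
            have : (2 : ℤ) ^ 3 ≤ (N : ℤ) ^ 9 := by
              calc (2 : ℤ) ^ 3 ≤ (N : ℤ) ^ 3 := by gcongr
                _ ≤ _ := by gcongr <;> first | linarith | norm_num
            gcongr
          _ = _ := by ring
    have hpos := Hq_pos ((c : ℚ) * ((p.2 : ℤ) : ℚ) * d / W p)
    generalize Hq ((c : ℚ) * ((p.2 : ℤ) : ℚ) * d / W p) = H at *
    have hR : ((H : ℝ)) ^ 3 ≤ (N : ℝ) ^ 15 * (d : ℝ) ^ 4 := by exact_mod_cast hH3
    have hHR : (0 : ℝ) < H := by exact_mod_cast (by omega : 0 < H)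
    have := Real.log_le_log (by positivity) hR
    rw [Real.log_mul (by positivity) (by positivity), Real.log_pow, Real.log_pow, Real.log_pow] at this
    push_cast at this
    linarith
  have hcard : (T.image Pt).card = T.card := Finset.card_image_of_injOn hinj
  rw [← hcard, ← descT_card]
  refine pk_triple (ht e₁ e₂ e₃) (Real.log ((648 * ((N : ℤ) ^ 2) ^ 7 : ℤ) : ℝ)) lC0 ht_neg
    (ht_add b1 b2 b3 hm1) (ht_dbl f12 f13 f23 b1 b2 b3 hm1) ht_finite
    (descMap e₁ e₂ e₃) (descMap_spec f12 f13 f23)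
    (2 / 3 * Real.log d - 3 * Real.log N) (5 * Real.log N + 4 / 3 * Real.log d) ?_ ?_ ?_ _ ?_ ?_
  · linarith
  · linarith
  · linarith
  · intro P hP
    obtain ⟨p, hp, rfl⟩ := Finset.mem_image.mp hP
    exact hhb p hp
  · intro P hP P' hP' P'' hP'' n1 n2 n3
    obtain ⟨p, hp, rfl⟩ := Finset.mem_image.mp hP
    obtain ⟨p', hp', rfl⟩ := Finset.mem_image.mp hP'
    obtain ⟨p'', hp'', rfl⟩ := Finset.mem_image.mp hP''
    have t1 := hpair p hp p' hp' (fun h => n1 (by rw [h]))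
    have t2 := hpair p hp p'' hp'' (fun h => n2 (by rw [h]))
    have t3 := hpair p' hp' p'' hp'' (fun h => n3 (by rw [h]))
    have hdv : ∀ p ∈ T, ∀ p' ∈ T, d ∣ Y p ^ 2 - Y p' ^ 2 := by
      intro p hp p' hp'
      have := dvd_sub (hYa p hp) (hYa p' hp')
      rwa [sub_sub_sub_cancel_right] at this
    have h3g := three_gcd d (Y p) (Y p') (Y p'') (hdv p hp p' hp') (hdv p hp p'' hp'')
    have g1 := hgpos (Y p - Y p')
    have g2 := hgpos (Y p - Y p'')
    have g3 := hgpos (Y p' - Y p'')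
    generalize (Int.gcd d (Y p - Y p') : ℤ) = u at *
    generalize (Int.gcd d (Y p - Y p'') : ℤ) = v at *
    generalize (Int.gcd d (Y p' - Y p'') : ℤ) = w at *
    have hle : d ≤ u * v * w := Int.le_of_dvd (by positivity) h3g
    have hleR : (d : ℝ) ≤ u * v * w := by exact_mod_cast hle
    have u0 : (u : ℝ) ≠ 0 := by exact_mod_cast (by omega : u ≠ 0)
    have v0 : (v : ℝ) ≠ 0 := by exact_mod_cast (by omega : v ≠ 0)
    have w0 : (w : ℝ) ≠ 0 := by exact_mod_cast (by omega : w ≠ 0)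
    have := Real.log_le_log hdR hleR
    rw [Real.log_mul (mul_ne_zero u0 v0) w0, Real.log_mul u0 v0] at this
    by_contra! hcon
    obtain ⟨k1, k2, k3⟩ := hcon
    linarith
end PTS


/-- Points starting a pattern. -/
def pat (A : Finset ℕ) (L q n : ℕ) : Prop :=
  ∃ c₁ c₂ c₃ : ℕ, (0 < c₁ ∧ c₁ < L) ∧ (0 < c₂ ∧ c₂ < L) ∧ (0 < c₃ ∧ c₃ < L) ∧
    c₁ ≠ c₂ ∧ c₁ ≠ c₃ ∧ c₂ ≠ c₃ ∧ n + c₁ * q ∈ A ∧ n + c₂ * q ∈ A ∧ n + c₃ * q ∈ A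

open scoped Classical in
theorem bad_le (A : Finset ℕ) (N L q : ℕ) (hA : ∀ n ∈ A, n < N) (hL : 1 ≤ L) (hq : 1 ≤ q) :
    (A.filter (fun n => ¬ pat A L q n)).card ≤ 3 * (N / L + q) := by
  have hb : (Finset.range q ×ˢ Finset.range (N / q / L + 1)).card ≤ N / L + q := by
    rw [Finset.card_product, Finset.card_range, Finset.card_range]
    have : q * (N / q / L) ≤ N / L := by
      rw [Nat.div_div_eq_div_mul, mul_comm q L, ← Nat.div_div_eq_div_mul]
      exact Nat.mul_div_le _ _
    rw [mul_add, mul_one]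
    omega
  refine le_trans ?_ (Nat.mul_le_mul_left 3 hb)
  refine Finset.card_le_mul_card_image_of_maps_to (f := fun n => (n % q, n / q / L)) ?_ _ ?_
  · intro n hn
    rw [Finset.mem_filter] at hn
    have h1 := hA n hn.1
    rw [Finset.mem_product, Finset.mem_range, Finset.mem_range]
    refine ⟨Nat.mod_lt _ hq, ?_⟩
    have : n / q / L ≤ N / q / L := Nat.div_le_div_right (Nat.div_le_div_right h1.le)
    simp only
    omega
  · rintro ⟨r, j⟩ _
    by_contra hcon
    push Not at hcon
    set F := (A.filter (fun n => ¬ pat A L q n)).filter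
      (fun n => (n % q, n / q / L) = (r, j)) with hF
    have hne : F.Nonempty := Finset.card_pos.mp (by omega)
    set m := F.min' hne with hm
    have hmF : m ∈ F := F.min'_mem hne
    have hmm : ∀ n ∈ F, m ≤ n := fun n hn => F.min'_le n hn
    have hc : 2 < (F.erase m).card := by
      rw [Finset.card_erase_of_mem hmF]; omega
    have hmem : ∀ n ∈ F, n ∈ A ∧ n % q = r ∧ n / q / L = j := by
      intro n hn
      rw [hF, Finset.mem_filter, Finset.mem_filter] at hn
      refine ⟨hn.1.1, ?_, ?_⟩
      · exact congrArg Prod.fst hn.2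
      · exact congrArg Prod.snd hn.2
    have hex : ∀ n ∈ F.erase m, ∃ c, (0 < c ∧ c < L) ∧ n = m + c * q := by
      intro n hn
      rw [Finset.mem_erase] at hn
      obtain ⟨-, a1, a2⟩ := hmem n hn.2
      obtain ⟨-, b1, b2⟩ := hmem m hmF
      have h1 := hmm n hn.2
      have h2 : m < n := lt_of_le_of_ne h1 (Ne.symm hn.1)
      have e1 := Nat.mod_add_div n q
      have e2 := Nat.mod_add_div m q
      rw [a1] at e1
      rw [b1] at e2
      set s := n / q
      set t := m / q
      have hst : t < s := by
        by_contra hcc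
        push Not at hcc
        have := Nat.mul_le_mul_left q hcc
        omega
      refine ⟨s - t, ⟨by omega, ?_⟩, ?_⟩
      · have f1 := Nat.mod_add_div s L
        have f2 := Nat.mod_add_div t L
        rw [a2] at f1
        rw [b2] at f2
        have := Nat.mod_lt s hL
        omega
      · rw [Nat.sub_mul, mul_comm s, mul_comm t]
        have := Nat.mul_le_mul_left q hst.le
        omega
    rw [Finset.two_lt_card] at hc
    obtain ⟨a, ha, b, hb, c, hc, hab, hac, hbc⟩ := hc
    obtain ⟨c₁, h1, rfl⟩ := hex a ha
    obtain ⟨c₂, h2, rfl⟩ := hex b hb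
    obtain ⟨c₃, h3, rfl⟩ := hex c hc
    have hmp : ¬ pat A L q m := by
      have := hmF
      rw [hF, Finset.mem_filter, Finset.mem_filter] at this
      exact this.1.2
    apply hmp
    refine ⟨c₁, c₂, c₃, h1, h2, h3, ?_, ?_, ?_, ?_, ?_, ?_⟩
    · rintro rfl; exact hab rfl
    · rintro rfl; exact hac rfl
    · rintro rfl; exact hbc rfl
    · exact (hmem _ (Finset.mem_erase.mp ha).2).1
    · exact (hmem _ (Finset.mem_erase.mp hb).2).1
    · exact (hmem _ (Finset.mem_erase.mp hc).2).1

theorem counting (A : Finset ℕ) (N L Q K : ℕ) (hA : ∀ n ∈ A, n < N) (hL : 1 ≤ L)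
    (hM : 6 * (N / L + Q) ≤ A.card)
    (hK : ∀ c₁ c₂ c₃ : ℕ, (0 < c₁ ∧ c₁ < L) → (0 < c₂ ∧ c₂ < L) → (0 < c₃ ∧ c₃ < L) →
      c₁ ≠ c₂ → c₁ ≠ c₃ → c₂ ≠ c₃ →
      ((A ×ˢ Finset.Icc 1 Q).filter (fun p => p.1 + c₁ * p.2 ∈ A ∧ p.1 + c₂ * p.2 ∈ A ∧
        p.1 + c₃ * p.2 ∈ A)).card ≤ K) :
    Q * A.card ≤ 2 * (K * L ^ 3) := by
  classical
  set Pairs := (A ×ˢ Finset.Icc 1 Q).filter (fun p => pat A L p.2 p.1) with hP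
  have hlow : Q * A.card ≤ 2 * Pairs.card := by
    have h1 : ∀ q ∈ Finset.Icc 1 Q, A.card ≤ 2 * (Pairs.filter (fun p => p.2 = q)).card := by
      intro q hq
      rw [Finset.mem_Icc] at hq
      have h2 := bad_le A N L q hA hL hq.1
      have h3 := Finset.card_filter_add_card_filter_not (s := A) (fun n => pat A L q n)
      have h4 : (A.filter (fun n => pat A L q n)).card ≤
          (Pairs.filter (fun p => p.2 = q)).card := by
        refine Finset.card_le_card_of_injOn (fun n => (n, q)) ?_ ?_
        · intro n hn
          rw [Finset.mem_coe, Finset.mem_filter] at hn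
          rw [Finset.mem_coe, Finset.mem_filter, hP, Finset.mem_filter, Finset.mem_product,
            Finset.mem_Icc]
          exact ⟨⟨⟨hn.1, hq⟩, hn.2⟩, rfl⟩
        · intro n _ m _ h
          exact congrArg Prod.fst h
      have h5 : 3 * (N / L + q) ≤ 3 * (N / L + Q) := by omega
      omega
    have h2 : Pairs.card = ∑ q ∈ Finset.Icc 1 Q, (Pairs.filter (fun p => p.2 = q)).card := by
      apply Finset.card_eq_sum_card_fiberwise
      intro p hp
      rw [hP] at hp
      have := (Finset.mem_filter.mp hp).1
      exact (Finset.mem_product.mp this).2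
    rw [h2, Finset.mul_sum]
    calc Q * A.card = ∑ q ∈ Finset.Icc 1 Q, A.card := by simp
      _ ≤ _ := Finset.sum_le_sum h1
  have hup : Pairs.card ≤ K * L ^ 3 := by
    have hex : ∀ p ∈ Pairs, ∃ c : ℕ × ℕ × ℕ, (0 < c.1 ∧ c.1 < L) ∧ (0 < c.2.1 ∧ c.2.1 < L) ∧
        (0 < c.2.2 ∧ c.2.2 < L) ∧ c.1 ≠ c.2.1 ∧ c.1 ≠ c.2.2 ∧ c.2.1 ≠ c.2.2 ∧
        p.1 + c.1 * p.2 ∈ A ∧ p.1 + c.2.1 * p.2 ∈ A ∧ p.1 + c.2.2 * p.2 ∈ A := by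
      intro p hp
      rw [hP, Finset.mem_filter] at hp
      obtain ⟨c₁, c₂, c₃, h⟩ := hp.2
      exact ⟨(c₁, c₂, c₃), h⟩
    choose! c hc using hex
    have hcard : (Finset.range L ×ˢ Finset.range L ×ˢ Finset.range L).card = L ^ 3 := by
      simp only [Finset.card_product, Finset.card_range]; ring
    rw [← hcard]
    refine Finset.card_le_mul_card_image_of_maps_to (f := c) ?_ _ ?_
    · intro p hp
      have := hc p hp
      simp only [Finset.mem_product, Finset.mem_range]
      exact ⟨this.1.2, this.2.1.2, this.2.2.1.2⟩
    · rintro ⟨c₁, c₂, c₃⟩ -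
      rcases (Pairs.filter (fun p => c p = (c₁, c₂, c₃))).eq_empty_or_nonempty with he | ⟨p, hp⟩
      · rw [he]; simp
      · rw [Finset.mem_filter] at hp
        have h := hc p hp.1
        rw [hp.2] at h
        obtain ⟨h1, h2, h3, h4, h5, h6, -⟩ := h
        refine le_trans (Finset.card_le_card ?_) (hK c₁ c₂ c₃ h1 h2 h3 h4 h5 h6)
        intro p' hp'
        rw [Finset.mem_filter] at hp'
        have h' := hc p' hp'.1
        rw [hp'.2] at h'
        rw [Finset.mem_filter]
        have := hp'.1
        rw [hP, Finset.mem_filter] at this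
        exact ⟨this.1, h'.2.2.2.2.2.2⟩
  omega


theorem ev_rpow (s B : ℝ) (hs : 0 < s) : ∃ N₀ : ℕ, ∀ N : ℕ, N₀ ≤ N → B < (N : ℝ) ^ s := by
  have h := (tendsto_rpow_atTop hs).comp (tendsto_natCast_atTop_atTop (R := ℝ))
  have := h.eventually (Filter.eventually_gt_atTop B)
  exact Filter.eventually_atTop.mp this

theorem two_pow_omega {n : ℕ} (hn : n ≠ 0) : 2 ^ n.primeFactors.card ≤ n.divisors.card := by
  rw [Nat.card_divisors hn, ← Finset.prod_const]
  apply Finset.prod_le_prod'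
  intro p hp
  have := (Nat.prime_of_mem_primeFactors hp).factorization_pos_of_dvd hn
    (Nat.dvd_of_mem_primeFactors hp)
  omega

theorem K_bound {ε C : ℝ} (hε : 0 < ε) (hC1 : 1 ≤ C)
    (hC : ∀ n : ℕ, n ≠ 0 → (n.divisors.card : ℝ) ≤ C * (n : ℝ) ^ ε)
    {N : ℕ} (hN : 2 ≤ N) {e₁ e₂ e₃ : ℤ}
    (b1 : |e₁| ≤ (N : ℤ) ^ 2) (b2 : |e₂| ≤ (N : ℤ) ^ 2) (b3 : |e₃| ≤ (N : ℤ) ^ 2) :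
    ((4 + (2 * 2 ^ (badP e₁ e₂ e₃).card) ^ 2 : ℕ) : ℝ) ≤ 8 * (C * (N : ℝ) ^ (9 * ε)) ^ 2 := by
  have hNR : (2 : ℝ) ≤ N := by exact_mod_cast hN
  have hone : 1 ≤ C * (N : ℝ) ^ (9 * ε) := by
    have : 1 ≤ (N : ℝ) ^ (9 * ε) := Real.one_le_rpow (by linarith) (by positivity)
    nlinarith
  have hw : (2 : ℝ) ^ (badP e₁ e₂ e₃).card ≤ C * (N : ℝ) ^ (9 * ε) := by
    unfold badP
    by_cases h0 : ((e₁ - e₂) * (e₁ - e₃) * (e₂ - e₃)).natAbs = 0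
    · rw [h0]; simpa using hone
    have h := two_pow_omega h0
    have h' := hC _ h0
    have hle : |(e₁ - e₂) * (e₁ - e₃) * (e₂ - e₃)| ≤ (N : ℤ) ^ 9 := by
      have hN' : (2 : ℤ) ≤ N := by exact_mod_cast hN
      refine (prod_bd (prod_bd (diff_bd b1 b2) (diff_bd b1 b3)) (diff_bd b2 b3)).trans ?_
      calc _ = 2 ^ 3 * (N : ℤ) ^ 6 := by ring
        _ ≤ (N : ℤ) ^ 3 * (N : ℤ) ^ 6 := by gcongr
        _ = _ := by ring
    have hle' : (((e₁ - e₂) * (e₁ - e₃) * (e₂ - e₃)).natAbs : ℝ) ≤ (N : ℝ) ^ 9 := by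
      rw [Int.abs_eq_natAbs] at hle
      exact_mod_cast hle
    calc (2 : ℝ) ^ ((e₁ - e₂) * (e₁ - e₃) * (e₂ - e₃)).natAbs.primeFactors.card
        ≤ (((e₁ - e₂) * (e₁ - e₃) * (e₂ - e₃)).natAbs.divisors.card : ℝ) := by exact_mod_cast h
      _ ≤ _ := h'
      _ ≤ C * ((N : ℝ) ^ 9) ^ ε := by gcongr
      _ = C * (N : ℝ) ^ (9 * ε) := by
        rw [← Real.rpow_natCast, ← Real.rpow_mul (by linarith)]; norm_num
  push_cast
  generalize C * (N : ℝ) ^ (9 * ε) = t at *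
  have : (0 : ℝ) ≤ 2 ^ (badP e₁ e₂ e₃).card := by positivity
  generalize (2 : ℝ) ^ (badP e₁ e₂ e₃).card = s at *
  nlinarith

theorem small_case {ε C δ : ℝ} (hε : 0 < ε) (hC1 : 1 ≤ C) (hδ : 0 < δ)
    (hC : ∀ n : ℕ, n ≠ 0 → (n.divisors.card : ℝ) ≤ C * (n : ℝ) ^ ε)
    (hεδ : 8000 * ε = δ) (hδ1 : δ ≤ 1 / 10)
    {N : ℕ} (hN : 2 ≤ N) (hB : 3 * C < (N : ℝ) ^ (δ / 2)) (a d : ℤ) (hd : 1 ≤ d)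
    (hdN : d < (N : ℤ) ^ 400) (hcop : IsCoprime a d) :
    ((goodIdx N a d).card : ℝ) < (N : ℝ) ^ (3 / 5 + δ) := by
  have hNR : (2 : ℝ) ≤ N := by exact_mod_cast hN
  have h := small_d N a d hd hcop
  have hR : ((goodIdx N a d).card : ℝ) ≤ (Nat.sqrt (4 * N) + 1) * d.natAbs.divisors.card := by
    exact_mod_cast h
  have hs : ((Nat.sqrt (4 * N) : ℕ) : ℝ) + 1 ≤ 3 * (N : ℝ) ^ (1 / 2 : ℝ) := by
    rw [← Real.sqrt_eq_rpow]
    have h1 : ((Nat.sqrt (4 * N) : ℕ) : ℝ) ≤ Real.sqrt ((4 * N : ℕ) : ℝ) := Real.nat_sqrt_le_real_sqrt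
    have h2 : Real.sqrt ((4 * N : ℕ) : ℝ) = 2 * Real.sqrt N := by
      push_cast
      rw [Real.sqrt_mul (by norm_num), show (4 : ℝ) = 2 ^ 2 by norm_num,
        Real.sqrt_sq (by norm_num)]
    have h3 : 1 ≤ Real.sqrt N := Real.one_le_sqrt.mpr (by linarith)
    linarith
  have hτ : (d.natAbs.divisors.card : ℝ) ≤ C * (N : ℝ) ^ (400 * ε) := by
    have h0 : d.natAbs ≠ 0 := by omega
    have hle : (d.natAbs : ℝ) ≤ (N : ℝ) ^ 400 := by
      have : (d.natAbs : ℤ) ≤ (N : ℤ) ^ 400 := by omega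
      exact_mod_cast this
    calc (d.natAbs.divisors.card : ℝ) ≤ C * (d.natAbs : ℝ) ^ ε := hC _ h0
      _ ≤ C * ((N : ℝ) ^ 400) ^ ε := by gcongr
      _ = _ := by rw [← Real.rpow_natCast, ← Real.rpow_mul (by linarith)]; norm_num
  have hX : (0 : ℝ) < N := by linarith
  calc ((goodIdx N a d).card : ℝ) ≤ _ := hR
    _ ≤ (3 * (N : ℝ) ^ (1 / 2 : ℝ)) * (C * (N : ℝ) ^ (400 * ε)) := by gcongr
    _ = (3 * C) * (N : ℝ) ^ (1 / 2 + 400 * ε) := by rw [Real.rpow_add hX]; ring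
    _ < (N : ℝ) ^ (δ / 2) * (N : ℝ) ^ (1 / 2 + 400 * ε) := by gcongr
    _ = (N : ℝ) ^ (δ / 2 + (1 / 2 + 400 * ε)) := (Real.rpow_add hX _ _).symm
    _ ≤ (N : ℝ) ^ (3 / 5 + δ) := by
      apply Real.rpow_le_rpow_of_exponent_le (by linarith)
      linarith

theorem large_case {ε C δ : ℝ} (hε : 0 < ε) (hC1 : 1 ≤ C) (hδ : 0 < δ)
    (hC : ∀ n : ℕ, n ≠ 0 → (n.divisors.card : ℝ) ≤ C * (n : ℝ) ^ ε)
    (hεδ : 8000 * ε = δ) (hδ1 : δ ≤ 1 / 10)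
    {N : ℕ} (hN : 2 ≤ N) (hB1 : 12 < (N : ℝ) ^ (δ / 2))
    (hB2 : 128 * (8 * C ^ 2) ^ 16 < (N : ℝ) ^ (2 * δ)) (μ d : ℤ)
    (hdN : (N : ℤ) ^ 400 ≤ d) (hcop : IsCoprime (μ ^ 2) d) :
    ((goodIdx N (μ ^ 2) d).card : ℝ) < (N : ℝ) ^ (3 / 5 + δ) := by
  by_contra! hcon
  have hNR : (2 : ℝ) ≤ N := by exact_mod_cast hN
  have hX : (0 : ℝ) < N := by linarith
  obtain ⟨E, hE⟩ : ∃ E : ℝ, E = (N : ℝ) ^ (2 / 5 - δ / 2) := ⟨_, rfl⟩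
  have hE1 : 1 ≤ E := by rw [hE]; exact Real.one_le_rpow (by linarith) (by linarith)
  obtain ⟨F, hF⟩ : ∃ F : ℝ, F = (N : ℝ) ^ (3 / 5 + δ / 2) := ⟨_, rfl⟩
  have hEF : E * F = N := by
    rw [hE, hF, ← Real.rpow_add hX]; ring_nf; exact Real.rpow_one _
  have hF12 : 12 < F := by
    refine hB1.trans_le ?_
    rw [hF]
    exact Real.rpow_le_rpow_of_exponent_le (by linarith) (by linarith)
  have hFM : 12 * F ≤ ((goodIdx N (μ ^ 2) d).card : ℝ) := by
    refine le_trans ?_ hcon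
    calc 12 * F ≤ (N : ℝ) ^ (δ / 2) * F := by gcongr
      _ = _ := by rw [hF, ← Real.rpow_add hX]; ring_nf
  obtain ⟨L, hL⟩ : ∃ L : ℕ, L = ⌈E⌉₊ := ⟨_, rfl⟩
  have hEL : E ≤ L := by rw [hL]; exact Nat.le_ceil _
  have hLE : (L : ℝ) ≤ 2 * E := by
    have := Nat.ceil_lt_add_one (by linarith : 0 ≤ E)
    rw [hL]; linarith
  have hLpos : (0 : ℝ) < L := by linarith
  have hL1 : 1 ≤ L := by exact_mod_cast hLpos
  have hLN : L ≤ N := by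
    have : (L : ℝ) ≤ N := by nlinarith
    exact_mod_cast this
  obtain ⟨Q, hQ⟩ : ∃ Q : ℕ, Q = N / L := ⟨_, rfl⟩
  have hQ1 : 1 ≤ Q := by rw [hQ]; exact Nat.div_pos hLN hL1
  have hQN : Q ≤ N := by rw [hQ]; exact Nat.div_le_self _ _
  have hQF : (Q : ℝ) ≤ F := by
    rw [hQ]
    calc ((N / L : ℕ) : ℝ) ≤ N / L := Nat.cast_div_le
      _ ≤ N / E := by gcongr
      _ = F := by rw [← hEF]; field_simp
  have hNQ : (N : ℝ) ≤ 2 * L * Q := by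
    have h1 : N < L * (Q + 1) := by rw [hQ]; exact Nat.lt_mul_div_succ N hL1
    have h2 : N ≤ 2 * L * Q := by nlinarith
    exact_mod_cast h2
  have h3 : 3 ≤ (goodIdx N (μ ^ 2) d).card := by
    have : (3 : ℝ) ≤ ((goodIdx N (μ ^ 2) d).card : ℝ) := by linarith
    exact_mod_cast this
  obtain ⟨Kr, hKr⟩ : ∃ Kr : ℝ, Kr = 2 * (8 * (C * (N : ℝ) ^ (9 * ε)) ^ 2) ^ 16 := ⟨_, rfl⟩
  have hKr0 : 0 ≤ Kr := by rw [hKr]; positivity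
  have hcount := counting (goodIdx N (μ ^ 2) d) N L Q ⌊Kr⌋₊ (fun n hn => (mem_goodIdx.mp hn).1) hL1
    (by
      rw [← hQ]
      have : (6 * (Q + Q) : ℝ) ≤ ((goodIdx N (μ ^ 2) d).card : ℝ) := by linarith
      exact_mod_cast this)
    (by
      intro c₁ c₂ c₃ p₁ p₂ p₃ h12 h13 h23
      have q₁ := p₁.2.trans_le hLN
      have q₂ := p₂.2.trans_le hLN
      have q₃ := p₃.2.trans_le hLN
      have hp := pts_bound N Q hN hQN μ d hdN hcop h3 c₁ c₂ c₃ ⟨p₁.1, q₁⟩ ⟨p₂.1, q₂⟩ ⟨p₃.1, q₃⟩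
        h12 h13 h23
      have hbd : ∀ u v : ℕ, u < N → v < N → |(-(u * v : ℤ))| ≤ (N : ℤ) ^ 2 := by
        intro u v hu hv
        rw [abs_neg, abs_of_nonneg (by positivity), sq]
        have hu' : (u : ℤ) ≤ N := by exact_mod_cast hu.le
        have hv' : (v : ℤ) ≤ N := by exact_mod_cast hv.le
        gcongr
      have hk := K_bound hε hC1 hC hN (hbd c₂ c₃ q₂ q₃) (hbd c₁ c₃ q₁ q₃) (hbd c₁ c₂ q₁ q₂)
      apply Nat.le_floor
      rw [hKr]
      refine le_trans (b := ((2 * (4 + (2 * 2 ^ (badP (-(c₂ * c₃ : ℤ)) (-(c₁ * c₃ : ℤ))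
        (-(c₁ * c₂ : ℤ))).card) ^ 2) ^ 16 : ℕ) : ℝ)) ?_ ?_
      · refine Nat.cast_le.mpr (le_trans (le_of_eq ?_) hp)
        congr!
      · rw [Nat.cast_mul, Nat.cast_pow]
        gcongr
        norm_num)
  obtain ⟨M, hM⟩ : ∃ M : ℕ, M = (goodIdx N (μ ^ 2) d).card := ⟨_, rfl⟩
  rw [← hM] at hcount hcon
  have hcR : (Q : ℝ) * M ≤ 2 * (Kr * (L : ℝ) ^ 3) := by
    have h1 : (Q : ℝ) * M ≤ 2 * ((⌊Kr⌋₊ : ℝ) * (L : ℝ) ^ 3) := by exact_mod_cast hcount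
    have h2 := Nat.floor_le hKr0
    refine h1.trans ?_
    gcongr
  have hmain : (N : ℝ) * (N : ℝ) ^ (3 / 5 + δ) ≤ 64 * Kr * E ^ 4 := by
    calc (N : ℝ) * (N : ℝ) ^ (3 / 5 + δ) ≤ (2 * L * Q) * M := by gcongr
      _ = 2 * L * (Q * M) := by ring
      _ ≤ 2 * L * (2 * (Kr * (L : ℝ) ^ 3)) := by gcongr
      _ = 4 * Kr * (L : ℝ) ^ 4 := by ring
      _ ≤ 4 * Kr * (2 * E) ^ 4 := by gcongr
      _ = _ := by ring
  have hE4 : E ^ 4 = (N : ℝ) ^ (8 / 5 - 2 * δ) := by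
    rw [hE, ← Real.rpow_natCast, ← Real.rpow_mul hX.le]; congr 1; push_cast; ring
  have hKe : 64 * Kr = 128 * (8 * C ^ 2) ^ 16 * (N : ℝ) ^ (288 * ε) := by
    have : (N : ℝ) ^ (288 * ε) = ((N : ℝ) ^ (9 * ε)) ^ 32 := by
      rw [← Real.rpow_natCast, ← Real.rpow_mul hX.le]; congr 1; push_cast; ring
    rw [hKr, this]; ring
  rw [hE4, hKe] at hmain
  have hlt : 128 * (8 * C ^ 2) ^ 16 * (N : ℝ) ^ (288 * ε) * (N : ℝ) ^ (8 / 5 - 2 * δ) <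
      (N : ℝ) ^ (2 * δ) * (N : ℝ) ^ (288 * ε) * (N : ℝ) ^ (8 / 5 - 2 * δ) := by gcongr
  have hle : (N : ℝ) ^ (2 * δ) * (N : ℝ) ^ (288 * ε) * (N : ℝ) ^ (8 / 5 - 2 * δ) ≤
      (N : ℝ) * (N : ℝ) ^ (3 / 5 + δ) := by
    rw [← Real.rpow_add hX, ← Real.rpow_add hX]
    nth_rewrite 2 [← Real.rpow_one (N : ℝ)]
    rw [← Real.rpow_add hX]
    apply Real.rpow_le_rpow_of_exponent_le (by linarith)
    linarith
  linarith

theorem bombieri_zannier (c : ℝ) (hc : 3 / 5 < c) :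
    ∃ N₀ : ℕ, ∀ N : ℕ, N₀ ≤ N →
      ∀ a d : ℤ, 1 ≤ d → (squaresInAP N a d : ℝ) < (N : ℝ) ^ c := by
  obtain ⟨δ, hδ⟩ : ∃ δ : ℝ, δ = min (c - 3 / 5) (1 / 10) := ⟨_, rfl⟩
  have hδ0 : 0 < δ := by rw [hδ]; exact lt_min (by linarith) (by norm_num)
  have hδc : 3 / 5 + δ ≤ c := by
    have : δ ≤ c - 3 / 5 := by rw [hδ]; exact min_le_left _ _
    linarith
  have hδ1 : δ ≤ 1 / 10 := by rw [hδ]; exact min_le_right _ _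
  obtain ⟨C, hC1, hC⟩ := dv_bound (δ / 8000) (by positivity)
  obtain ⟨N₁, hN₁⟩ := ev_rpow (δ / 2) (3 * C) (by positivity)
  obtain ⟨N₂, hN₂⟩ := ev_rpow (δ / 2) 12 (by positivity)
  obtain ⟨N₃, hN₃⟩ := ev_rpow (2 * δ) (128 * (8 * C ^ 2) ^ 16) (by positivity)
  refine ⟨max 2 (max N₁ (max N₂ N₃)), ?_⟩
  intro N hN a d hd
  simp only [max_le_iff] at hN
  obtain ⟨hN2, hn1, hn2, hn3⟩ := hN
  have hNR : (2 : ℝ) ≤ N := by exact_mod_cast hN2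
  refine lt_of_lt_of_le ?_ (Real.rpow_le_rpow_of_exponent_le (by linarith) hδc)
  rw [squaresInAP_eq]
  rcases red_coprime N a d hd with h0 | ⟨μ, d', hd', hcop, hle⟩
  · rw [h0]
    push_cast
    positivity
  refine lt_of_le_of_lt (Nat.cast_le.mpr hle) ?_
  rcases lt_or_ge d' ((N : ℤ) ^ 400) with h | h
  · exact small_case (by positivity) hC1 hδ0 hC (by ring) hδ1 hN2 (hN₁ N hn1) _ _ hd' h hcop
  · exact large_case (by positivity) hC1 hδ0 hC (by ring) hδ1 hN2 (hN₂ N hn2) (hN₃ N hn3) _ _ h hcop
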